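/- arXiv:2506.13376 — 10 statements merged into one kernel-verified Lean document; each statement's English description precedes it below -/
import Mathlib

section
/- Every element x of the group L can be written in exactly one way as x = λ₁x₁ + λ₂x₂ + λ₃x₃ + λ₄x₄ + λ·c with integers λ₁, λ₂, λ₃ ∈ {0,1}, 0 ≤ λ₄ < p, and λ ∈ ℤ (the normal form of x). -/
noncomputable section

/-- The defining relations `2x₁ - c, 2x₂ - c, 2x₃ - c, p·x₄ - c` inside the free abelian
group on five generators `x₁, x₂, x₃, x₄, c` (realized as `Fin 5 → ℤ`). -/
def rels (p : ℤ) : Set (Fin 5 → ℤ) :=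
  { (2 : ℤ) • (Pi.single 0 1 : Fin 5 → ℤ) - Pi.single 4 1,
    (2 : ℤ) • (Pi.single 1 1 : Fin 5 → ℤ) - Pi.single 4 1,
    (2 : ℤ) • (Pi.single 2 1 : Fin 5 → ℤ) - Pi.single 4 1,
    p • (Pi.single 3 1 : Fin 5 → ℤ) - Pi.single 4 1 }

/-- The Geigle-Lenzing group `L` of type `(2,2,2,p)`: the free abelian group on
`x₁, x₂, x₃, x₄, c` modulo the subgroup generated by the relations. -/
abbrev Lgrp (p : ℤ) := (Fin 5 → ℤ) ⧸ AddSubgroup.closure (rels p)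

/-- The images of the five generators in `L`; indices `0,1,2,3` give `x₁,x₂,x₃,x₄`, and
index `4` gives the canonical element `c`. -/
def gen (p : ℤ) (i : Fin 5) : Lgrp p := QuotientAddGroup.mk (Pi.single i 1)

/-- The canonical element `c` of `L`. -/
def cel (p : ℤ) : Lgrp p := gen p 4

/-- The dualizing element `ω = c − x₁ − x₂ − x₃ − x₄`. -/
def omg (p : ℤ) : Lgrp p := cel p - gen p 0 - gen p 1 - gen p 2 - gen p 3

/-- The submonoid `L₊` of `L` generated by `x₁, x₂, x₃, x₄, c`. -/
def Lplus (p : ℤ) : AddSubmonoid (Lgrp p) := AddSubmonoid.closure (Set.range (gen p))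

/-- The partial order on `L`: `x ≤ y` iff `y − x ∈ L₊`. -/
def Lle (p : ℤ) (x y : Lgrp p) : Prop := y - x ∈ Lplus p

/-- The set `G = {0, x₁ − x₂, x₁ − x₃, x₂ − x₃} ⊆ L`. -/
def Gset (p : ℤ) : Set (Lgrp p) :=
  {0, gen p 0 - gen p 1, gen p 0 - gen p 2, gen p 1 - gen p 2}

theorem mem_rels_closure (p : ℤ) (f : Fin 5 → ℤ) :
    f ∈ AddSubgroup.closure (rels p) ↔ ∃ a b c d : ℤ, f 0 = 2 * a ∧ f 1 = 2 * b ∧ f 2 = 2 * c ∧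
      f 3 = p * d ∧ f 4 = -(a + b + c + d) := by
  constructor
  · intro h
    induction h using AddSubgroup.closure_induction with
    | mem x hx =>
      rcases hx with rfl | rfl | rfl | rfl
      · exact ⟨1, 0, 0, 0, by simp [Pi.single_apply]⟩
      · exact ⟨0, 1, 0, 0, by simp [Pi.single_apply]⟩
      · exact ⟨0, 0, 1, 0, by simp [Pi.single_apply]⟩
      · exact ⟨0, 0, 0, 1, by simp [Pi.single_apply]⟩
    | zero => exact ⟨0, 0, 0, 0, by simp⟩
    | add x y _ _ hx hy =>
      obtain ⟨a, b, c, d, h0, h1, h2, h3, h4⟩ := hx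
      obtain ⟨a', b', c', d', k0, k1, k2, k3, k4⟩ := hy
      refine ⟨a + a', b + b', c + c', d + d', ?_, ?_, ?_, ?_, ?_⟩ <;>
        simp only [Pi.add_apply, h0, h1, h2, h3, h4, k0, k1, k2, k3, k4] <;> ring
    | neg x _ hx =>
      obtain ⟨a, b, c, d, h0, h1, h2, h3, h4⟩ := hx
      refine ⟨-a, -b, -c, -d, ?_, ?_, ?_, ?_, ?_⟩ <;>
        simp only [Pi.neg_apply, h0, h1, h2, h3, h4] <;> ring
  · rintro ⟨a, b, c, d, h0, h1, h2, h3, h4⟩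
    have e : f = a • ((2 : ℤ) • (Pi.single 0 1 : Fin 5 → ℤ) - Pi.single 4 1)
        + b • ((2 : ℤ) • (Pi.single 1 1 : Fin 5 → ℤ) - Pi.single 4 1)
        + c • ((2 : ℤ) • (Pi.single 2 1 : Fin 5 → ℤ) - Pi.single 4 1)
        + d • (p • (Pi.single 3 1 : Fin 5 → ℤ) - Pi.single 4 1) := by
      funext i
      fin_cases i <;> simp [Pi.single_apply, h0, h1, h2, h3, h4] <;> ring
    rw [e]
    refine add_mem (add_mem (add_mem ?_ ?_) ?_) ?_ <;>
      exact zsmul_mem (AddSubgroup.subset_closure (by simp [rels])) _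

theorem mk_eq_comb (p : ℤ) (w : Fin 5 → ℤ) (v : ℤ × ℤ × ℤ × ℤ × ℤ) :
    ((QuotientAddGroup.mk w : Lgrp p) = v.1 • gen p 0 + v.2.1 • gen p 1 + v.2.2.1 • gen p 2
            + v.2.2.2.1 • gen p 3 + v.2.2.2.2 • cel p) ↔
    ∃ a b c d : ℤ, v.1 - w 0 = 2 * a ∧ v.2.1 - w 1 = 2 * b ∧ v.2.2.1 - w 2 = 2 * c ∧
      v.2.2.2.1 - w 3 = p * d ∧ v.2.2.2.2 - w 4 = -(a + b + c + d) := by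
  have e : v.1 • gen p 0 + v.2.1 • gen p 1 + v.2.2.1 • gen p 2
            + v.2.2.2.1 • gen p 3 + v.2.2.2.2 • cel p = (QuotientAddGroup.mk
      (v.1 • Pi.single 0 1 + v.2.1 • Pi.single 1 1 + v.2.2.1 • Pi.single 2 1
            + v.2.2.2.1 • Pi.single 3 1 + v.2.2.2.2 • Pi.single 4 1 : Fin 5 → ℤ) : Lgrp p) := rfl
  rw [e, QuotientAddGroup.eq, mem_rels_closure]
  simp [Pi.single_apply, neg_add_eq_sub]

/-- Every element of `L` has a unique normal form
`x = λ₁x₁ + λ₂x₂ + λ₃x₃ + λ₄x₄ + λ·c` with `λ₁,λ₂,λ₃ ∈ {0,1}`, `0 ≤ λ₄ < p`, `λ ∈ ℤ`. -/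
theorem stmt_0 (p : ℤ) (hp : 2 ≤ p) (x : Lgrp p) :
    ∃! v : ℤ × ℤ × ℤ × ℤ × ℤ,
      (v.1 = 0 ∨ v.1 = 1) ∧ (v.2.1 = 0 ∨ v.2.1 = 1) ∧ (v.2.2.1 = 0 ∨ v.2.2.1 = 1) ∧
      (0 ≤ v.2.2.2.1 ∧ v.2.2.2.1 < p) ∧
      x = v.1 • gen p 0 + v.2.1 • gen p 1 + v.2.2.1 • gen p 2
            + v.2.2.2.1 • gen p 3 + v.2.2.2.2 • cel p := by
  obtain ⟨w, rfl⟩ := QuotientAddGroup.mk_surjective x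
  simp only [mk_eq_comb]
  refine ⟨(w 0 % 2, w 1 % 2, w 2 % 2, w 3 % p,
    w 4 + w 0 / 2 + w 1 / 2 + w 2 / 2 + w 3 / p), ?_, ?_⟩
  · refine ⟨by dsimp only; omega, by dsimp only; omega, by dsimp only; omega,
      ⟨Int.emod_nonneg _ (by omega), Int.emod_lt_of_pos _ (by omega)⟩,
      -(w 0 / 2), -(w 1 / 2), -(w 2 / 2), -(w 3 / p), ?_⟩
    have := Int.emod_add_mul_ediv (w 3) p
    refine ⟨?_, ?_, ?_, ?_, ?_⟩ <;> dsimp only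
    · omega
    · omega
    · omega
    · linarith
    · ring
  · rintro ⟨v0, v1, v2, v3, v4⟩ ⟨h0, h1, h2, ⟨h3, h3'⟩, a, b, c, d, k0, k1, k2, k3, k4⟩
    dsimp only at *
    have hw : w 3 = v3 + p * (-d) := by linarith
    have m : w 3 % p = v3 := by
      rw [hw, Int.add_mul_emod_self_left, Int.emod_eq_of_lt h3 h3']
    have q : w 3 / p = -d := by
      rw [hw, Int.add_mul_ediv_left _ _ (by omega), Int.ediv_eq_zero_of_lt h3 h3', zero_add]
    rw [m, q]
    simp only [Prod.mk.injEq]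
    refine ⟨?_, ?_, ?_, trivial, ?_⟩ <;> omega
end
end

section
/- For an element x of L with normal form x = λ₁x₁ + λ₂x₂ + λ₃x₃ + λ₄x₄ + λ·c (where λ₁, λ₂, λ₃ ∈ {0,1}, 0 ≤ λ₄ < p, λ ∈ ℤ), one has x ∈ L₊ if and only if λ ≥ 0. -/
noncomputable section

theorem mem_rels_aux (p : ℤ) (v : Fin 5 → ℤ) (hv : v ∈ AddSubgroup.closure (rels p)) :
    ∃ a b c d : ℤ, v 0 = 2 * a ∧ v 1 = 2 * b ∧ v 2 = 2 * c ∧ v 3 = p * d ∧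
      v 4 = -(a + b + c + d) := by
  induction hv using AddSubgroup.closure_induction with
  | mem x hx =>
    simp only [rels, Set.mem_insert_iff, Set.mem_singleton_iff] at hx
    rcases hx with rfl | rfl | rfl | rfl
    · exact ⟨1, 0, 0, 0, by simp⟩
    · exact ⟨0, 1, 0, 0, by simp⟩
    · exact ⟨0, 0, 1, 0, by simp⟩
    · exact ⟨0, 0, 0, 1, by simp⟩
  | zero => exact ⟨0, 0, 0, 0, by simp⟩
  | add x y _ _ hx hy =>
    obtain ⟨a, b, c, d, e0, e1, e2, e3, e4⟩ := hx
    obtain ⟨a', b', c', d', f0, f1, f2, f3, f4⟩ := hy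
    refine ⟨a + a', b + b', c + c', d + d', ?_, ?_, ?_, ?_, ?_⟩ <;>
      simp only [Pi.add_apply, *] <;> ring
  | neg x _ hx =>
    obtain ⟨a, b, c, d, e0, e1, e2, e3, e4⟩ := hx
    refine ⟨-a, -b, -c, -d, ?_, ?_, ?_, ?_, ?_⟩ <;>
      simp only [Pi.neg_apply, *] <;> ring

theorem mem_Lplus_aux (p : ℤ) (x : Lgrp p) (hx : x ∈ Lplus p) :
    ∃ v : Fin 5 → ℤ, (∀ i, 0 ≤ v i) ∧ (QuotientAddGroup.mk v : Lgrp p) = x := by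
  unfold Lplus at hx
  induction hx using AddSubmonoid.closure_induction with
  | mem x hx =>
    obtain ⟨i, rfl⟩ := hx
    refine ⟨Pi.single i 1, fun j => ?_, rfl⟩
    rw [Pi.single_apply]
    split_ifs <;> norm_num
  | zero => exact ⟨0, fun _ => le_rfl, rfl⟩
  | add x y _ _ hx hy =>
    obtain ⟨v, hv, rfl⟩ := hx
    obtain ⟨w, hw, rfl⟩ := hy
    exact ⟨v + w, fun i => add_nonneg (hv i) (hw i), rfl⟩

theorem zsmul_gen_mem_aux (p : ℤ) (i : Fin 5) (n : ℤ) (hn : 0 ≤ n) :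
    n • gen p i ∈ Lplus p := by
  lift n to ℕ using hn
  rw [natCast_zsmul]
  have h : gen p i ∈ Lplus p := AddSubmonoid.subset_closure (Set.mem_range_self i)
  exact nsmul_mem h n

/-- For `x ∈ L` with normal form `x = λ₁x₁ + λ₂x₂ + λ₃x₃ + λ₄x₄ + λ·c`,
one has `x ∈ L₊` iff `λ ≥ 0`. -/
theorem stmt_1 (p : ℤ) (hp : 2 ≤ p) (l1 l2 l3 l4 l : ℤ)
    (h1 : l1 = 0 ∨ l1 = 1) (h2 : l2 = 0 ∨ l2 = 1) (h3 : l3 = 0 ∨ l3 = 1)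
    (h4 : 0 ≤ l4) (h4' : l4 < p) :
    l1 • gen p 0 + l2 • gen p 1 + l3 • gen p 2 + l4 • gen p 3 + l • cel p ∈ Lplus p ↔
      0 ≤ l := by
  constructor
  · intro h
    obtain ⟨v, hv, he⟩ := mem_Lplus_aux p _ h
    have he' : (QuotientAddGroup.mk v : Lgrp p) = QuotientAddGroup.mk
        (l1 • (Pi.single 0 1 : Fin 5 → ℤ) + l2 • Pi.single 1 1 + l3 • Pi.single 2 1 +
          l4 • Pi.single 3 1 + l • Pi.single 4 1) := he
    rw [QuotientAddGroup.eq] at he'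
    obtain ⟨a, b, c, d, e0, e1, e2, e3, e4⟩ := mem_rels_aux p _ he'
    simp at e0 e1 e2 e3 e4
    have v0 := hv 0
    have v1 := hv 1
    have v2 := hv 2
    have v3 := hv 3
    have v4 := hv 4
    have hd : d ≤ 0 := by
      by_contra hd
      have : 1 ≤ d := by omega
      nlinarith
    omega
  · intro hl
    have g1 : 0 ≤ l1 := by omega
    have g2 : 0 ≤ l2 := by omega
    have g3 : 0 ≤ l3 := by omega
    exact add_mem (add_mem (add_mem (add_mem (zsmul_gen_mem_aux p 0 l1 g1)
      (zsmul_gen_mem_aux p 1 l2 g2)) (zsmul_gen_mem_aux p 2 l3 g3))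
      (zsmul_gen_mem_aux p 3 l4 h4)) (zsmul_gen_mem_aux p 4 l hl)
end
end

section
/- Every element x of L satisfies exactly one of the two conditions: x ≥ 0, or x ≤ ω + 2c. -/
noncomputable section

/-- The `c`-coefficient of the normal form. -/
def nf (p : ℤ) (v : Fin 5 → ℤ) : ℤ := v 4 + v 0 / 2 + v 1 / 2 + v 2 / 2 + v 3 / p

lemma nf_add_rel (p : ℤ) (hp : 2 ≤ p) (r : Fin 5 → ℤ)
    (hr : r ∈ AddSubgroup.closure (rels p)) : ∀ v, nf p (v + r) = nf p v := by
  induction hr using AddSubgroup.closure_induction with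
  | mem r hr =>
    intro v
    have hp0 : p ≠ 0 := by omega
    have h3 : (v 3 + p) / p = v 3 / p + 1 := by
      simpa using Int.add_mul_ediv_right (v 3) 1 hp0
    rcases hr with rfl | rfl | rfl | rfl <;> simp [nf, Pi.single_apply]
    · omega
    · omega
    · omega
    · rw [h3]; omega
  | zero => simp
  | add a b _ _ ha hb => intro v; rw [← add_assoc, hb, ha]
  | neg a _ ha => intro v; rw [← ha (v + -a)]; simp

lemma nf_congr (p : ℤ) (hp : 2 ≤ p) (u v : Fin 5 → ℤ)
    (h : (QuotientAddGroup.mk u : Lgrp p) = QuotientAddGroup.mk v) : nf p u = nf p v := by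
  have := nf_add_rel p hp _ (QuotientAddGroup.eq.1 h) u
  simpa using this.symm

lemma ediv_superadd (p : ℤ) (hp : 2 ≤ p) (a b : ℤ) : a / p + b / p ≤ (a + b) / p := by
  rw [Int.le_ediv_iff_mul_le (by omega)]
  have h1 := Int.ediv_mul_le a (b := p) (by omega)
  have h2 := Int.ediv_mul_le b (b := p) (by omega)
  rw [add_mul]; omega

lemma nf_superadd (p : ℤ) (hp : 2 ≤ p) (u v : Fin 5 → ℤ) :
    nf p u + nf p v ≤ nf p (u + v) := by
  have := ediv_superadd p hp (u 3) (v 3)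
  simp only [nf, Pi.add_apply]
  omega

lemma nf_nonneg (p : ℤ) (hp : 2 ≤ p) (x : Lgrp p) (hx : x ∈ Lplus p) :
    ∀ v : Fin 5 → ℤ, QuotientAddGroup.mk v = x → 0 ≤ nf p v := by
  induction hx using AddSubmonoid.closure_induction with
  | mem x hx =>
    obtain ⟨i, rfl⟩ := hx
    intro v hv
    rw [nf_congr p hp _ _ hv]
    have h : 0 ≤ 1 / p := Int.ediv_nonneg (by omega) (by omega)
    fin_cases i <;> simp [nf, Pi.single_apply, h]
  | zero =>
    intro v hv
    rw [nf_congr p hp v 0 hv]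
    simp [nf]
  | add x y _ _ hx hy =>
    intro v hv
    obtain ⟨a, rfl⟩ := QuotientAddGroup.mk_surjective x
    obtain ⟨b, rfl⟩ := QuotientAddGroup.mk_surjective y
    rw [nf_congr p hp v (a + b) hv]
    have := nf_superadd p hp a b
    have := hx a rfl
    have := hy b rfl
    omega

lemma rel_eq (p : ℤ) (k : ℤ) (i : Fin 5)
    (h : k • (Pi.single i 1 : Fin 5 → ℤ) - Pi.single 4 1 ∈ rels p) :
    k • gen p i = gen p 4 := by
  have h1 := (QuotientAddGroup.eq_zero_iff _).2 (AddSubgroup.subset_closure h)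
  exact sub_eq_zero.1 h1

lemma mk_eq_sum (p : ℤ) (v : Fin 5 → ℤ) : (QuotientAddGroup.mk v : Lgrp p) =
    v 0 • gen p 0 + v 1 • gen p 1 + v 2 • gen p 2 + v 3 • gen p 3 + v 4 • gen p 4 := by
  have : v = v 0 • Pi.single 0 1 + v 1 • Pi.single 1 1 + v 2 • Pi.single 2 1
      + v 3 • Pi.single 3 1 + v 4 • Pi.single 4 1 := by
    ext i; fin_cases i <;> simp [Pi.single_apply]
  conv_lhs => rw [this]
  rfl

lemma zsmul_mem_plus (p : ℤ) (k : ℤ) (hk : 0 ≤ k) (i : Fin 5) : k • gen p i ∈ Lplus p := by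
  lift k to ℕ using hk
  rw [natCast_zsmul]
  exact AddSubmonoid.nsmul_mem _ (AddSubmonoid.subset_closure (Set.mem_range_self i)) _

lemma mem_plus_iff (p : ℤ) (hp : 2 ≤ p) (v : Fin 5 → ℤ) :
    (QuotientAddGroup.mk v : Lgrp p) ∈ Lplus p ↔ 0 ≤ nf p v := by
  refine ⟨fun h => nf_nonneg p hp _ h v rfl, fun h => ?_⟩
  have r0 := rel_eq p 2 0 (by simp [rels])
  have r1 := rel_eq p 2 1 (by simp [rels])
  have r2 := rel_eq p 2 2 (by simp [rels])
  have r3 := rel_eq p p 3 (by simp [rels])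
  have key : ∀ (k a : ℤ) (i : Fin 5), k • gen p i = gen p 4 →
      a • gen p i = (a % k) • gen p i + (a / k) • gen p 4 := by
    intro k a i hk
    rw [← hk, smul_smul, ← add_zsmul]
    congr 1
    rw [mul_comm]; exact (Int.emod_add_mul_ediv a k).symm
  have : (QuotientAddGroup.mk v : Lgrp p) = (v 0 % 2) • gen p 0 + (v 1 % 2) • gen p 1 +
      (v 2 % 2) • gen p 2 + (v 3 % p) • gen p 3 + nf p v • gen p 4 := by
    rw [mk_eq_sum, key 2 (v 0) 0 r0, key 2 (v 1) 1 r1, key 2 (v 2) 2 r2, key p (v 3) 3 r3, nf]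
    simp only [add_zsmul]
    abel
  rw [this]
  have m3 : 0 ≤ v 3 % p := Int.emod_nonneg _ (by omega)
  exact add_mem (add_mem (add_mem (add_mem (zsmul_mem_plus p _ (by omega) _)
    (zsmul_mem_plus p _ (by omega) _)) (zsmul_mem_plus p _ (by omega) _))
    (zsmul_mem_plus p _ m3 _)) (zsmul_mem_plus p _ h _)

lemma neg_ediv (p : ℤ) (hp : 2 ≤ p) (a : ℤ) : (-1 - a) / p = -1 - a / p := by
  have h1 := Int.emod_add_mul_ediv a p
  have h2 := Int.emod_nonneg a (b := p) (by omega)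
  have h3 := Int.emod_lt_of_pos a (b := p) (by omega)
  rw [Int.ediv_eq_iff_of_pos (by omega)]
  constructor <;> nlinarith

/-- Every `x ∈ L` satisfies exactly one of `x ≥ 0` and `x ≤ ω + 2c`. -/
theorem stmt_2 (p : ℤ) (hp : 2 ≤ p) (x : Lgrp p) :
    Xor' (Lle p 0 x) (Lle p x (omg p + (2 : ℤ) • cel p)) := by
  obtain ⟨v, rfl⟩ := QuotientAddGroup.mk_surjective x
  have e : omg p + (2 : ℤ) • cel p - QuotientAddGroup.mk v =
      (QuotientAddGroup.mk ![-1 - v 0, -1 - v 1, -1 - v 2, -1 - v 3, 3 - v 4] : Lgrp p) := by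
    rw [mk_eq_sum, mk_eq_sum]
    simp [omg, cel, sub_smul]
    abel
  have n : nf p ![-1 - v 0, -1 - v 1, -1 - v 2, -1 - v 3, 3 - v 4] = -1 - nf p v := by
    have := neg_ediv p hp (v 3)
    simp [nf] at *
    omega
  unfold Lle
  rw [e, sub_zero, mem_plus_iff p hp, mem_plus_iff p hp, n]
  unfold Xor'
  change (_ ∧ ¬ _) ∨ (_ ∧ ¬ _)
  omega
end
end

section
/- The quotient group L/⟨ω⟩ of L by the cyclic subgroup generated by ω is finite of order 4p + 8. -/
noncomputable section

/-- The five relation vectors of the quotient, as rows of a matrix. -/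
def relMat (p : ℤ) : Matrix (Fin 5) (Fin 5) ℤ :=
  !![2, 0, 0, 0, -1; 0, 2, 0, 0, -1; 0, 0, 2, 0, -1; 0, 0, 0, p, -1; -1, -1, -1, -1, 1]

theorem relMat_det (p : ℤ) : (relMat p).det = -(4 * p + 8) := by
  simp [relMat, Matrix.det_succ_row_zero, Fin.sum_univ_succ, Fin.succAbove]
  ring

theorem range_relMat (p : ℤ) : Set.range (relMat p).row =
    rels p ∪ {Pi.single 4 1 - Pi.single 0 1 - Pi.single 1 1 - Pi.single 2 1 - Pi.single 3 1} := by
  have h0 : (relMat p).row 0 = (2 : ℤ) • (Pi.single 0 1 : Fin 5 → ℤ) - Pi.single 4 1 := by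
    ext i; fin_cases i <;> simp [relMat]
  have h1 : (relMat p).row 1 = (2 : ℤ) • (Pi.single 1 1 : Fin 5 → ℤ) - Pi.single 4 1 := by
    ext i; fin_cases i <;> simp [relMat]
  have h2 : (relMat p).row 2 = (2 : ℤ) • (Pi.single 2 1 : Fin 5 → ℤ) - Pi.single 4 1 := by
    ext i; fin_cases i <;> simp [relMat]
  have h3 : (relMat p).row 3 = p • (Pi.single 3 1 : Fin 5 → ℤ) - Pi.single 4 1 := by
    ext i; fin_cases i <;> simp [relMat]
  have h4 : (relMat p).row 4 = (Pi.single 4 1 : Fin 5 → ℤ) - Pi.single 0 1 - Pi.single 1 1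
      - Pi.single 2 1 - Pi.single 3 1 := by
    ext i; fin_cases i <;> simp [relMat]
  ext x
  simp only [Set.mem_range, Fin.exists_fin_succ, rels, Set.mem_union, Set.mem_insert_iff,
    Set.mem_singleton_iff, ← h0, ← h1, ← h2, ← h3, ← h4, Fin.exists_fin_zero]
  simp only [eq_comm (b := x), or_assoc, or_false]
  rfl

theorem index_closure (p : ℤ) (hp : 2 ≤ p) :
    ((AddSubgroup.closure (Set.range (relMat p).row)).index : ℤ) = 4 * p + 8 := by
  have hd : (relMat p).det ≠ 0 := by rw [relMat_det]; omega
  have hli : LinearIndependent ℤ (relMat p).row :=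
    Matrix.linearIndependent_rows_of_det_ne_zero hd
  have hN : AddSubgroup.closure (Set.range (relMat p).row) =
      (Submodule.span ℤ (Set.range (relMat p).row)).toAddSubgroup :=
    (Submodule.span_int_eq_addSubgroupClosure _).symm
  rw [hN]
  have := Submodule.natAbs_det_basis_change (Pi.basisFun ℤ (Fin 5))
    (Submodule.span ℤ (Set.range (relMat p).row)) (Module.Basis.span hli)
  have h2 : (Subtype.val ∘ (Module.Basis.span hli)) = (relMat p).row := by
    ext i : 1
    simp [Module.Basis.span_apply]
  rw [h2, Pi.basisFun_det_apply] at this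
  have h3 : (Submodule.span ℤ (Set.range (relMat p).row)).toAddSubgroup.index =
      ((relMat p).det).natAbs := by
    have h4 : Matrix.of (relMat p).row = relMat p := rfl
    rw [h4] at this
    rw [this]
    rfl
  rw [h3, relMat_det]
  omega

theorem index_zmultiples_omg (p : ℤ) (hp : 2 ≤ p) :
    ((AddSubgroup.zmultiples (omg p)).index : ℤ) = 4 * p + 8 := by
  rw [← index_closure p hp, range_relMat, AddSubgroup.closure_union,
    ← AddSubgroup.zmultiples_eq_closure,
    ← AddSubgroup.index_comap_of_surjective (AddSubgroup.zmultiples (omg p))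
      (QuotientAddGroup.mk'_surjective (AddSubgroup.closure (rels p)))]
  have : AddSubgroup.zmultiples (omg p) = AddSubgroup.map
      (QuotientAddGroup.mk' (AddSubgroup.closure (rels p)))
      (AddSubgroup.zmultiples (Pi.single 4 1 - Pi.single 0 1 - Pi.single 1 1 - Pi.single 2 1
        - Pi.single 3 1)) := by
    rw [AddMonoidHom.map_zmultiples]
    rfl
  rw [this, AddSubgroup.comap_map_eq, QuotientAddGroup.ker_mk', sup_comm]

/-- The quotient `L/⟨ω⟩` is finite of order `4p + 8`. -/
theorem stmt_4 (p : ℤ) (hp : 2 ≤ p) :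
    Finite (Lgrp p ⧸ AddSubgroup.zmultiples (omg p)) ∧
      (Nat.card (Lgrp p ⧸ AddSubgroup.zmultiples (omg p)) : ℤ) = 4 * p + 8 := by
  have h := index_zmultiples_omg p hp
  refine ⟨?_, h⟩
  apply Nat.finite_of_card_ne_zero
  intro h0
  have h1 : (AddSubgroup.zmultiples (omg p)).index = 0 := h0
  rw [h1] at h
  push_cast at h
  omega
end
end

section
/- For an integer ℓ, the two inequalities −2c ≤ ℓ·ω and ℓ·ω ≤ 2c hold in L if and only if ℓ ∈ {−2, 0, 2}. -/
noncomputable section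

theorem rels_inv (p : ℤ) (w : Fin 5 → ℤ) (hw : w ∈ AddSubgroup.closure (rels p)) :
    2 ∣ w 0 ∧ 2 ∣ w 1 ∧ 2 ∣ w 2 ∧
      p * w 0 + p * w 1 + p * w 2 + 2 * w 3 + 2 * p * w 4 = 0 := by
  induction hw using AddSubgroup.closure_induction with
  | mem x hx =>
    simp only [rels, Set.mem_insert_iff, Set.mem_singleton_iff] at hx
    rcases hx with rfl | rfl | rfl | rfl <;> simp [Pi.single_apply] <;> ring
  | zero => simp
  | add x y _ _ hx hy =>
    obtain ⟨a, b, c, d⟩ := hx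
    obtain ⟨a2, b2, c2, d2⟩ := hy
    refine ⟨dvd_add a a2, dvd_add b b2, dvd_add c c2, ?_⟩
    simp only [Pi.add_apply]
    linarith
  | neg x _ hx =>
    obtain ⟨a, b, c, d⟩ := hx
    refine ⟨by simpa using a, by simpa using b, by simpa using c, ?_⟩
    simp only [Pi.neg_apply]
    linarith

theorem Lplus_rep (p : ℤ) (y : Lgrp p) (hy : y ∈ Lplus p) :
    ∃ n : Fin 5 → ℤ, (∀ i, 0 ≤ n i) ∧ y = QuotientAddGroup.mk n := by
  unfold Lplus at hy
  induction hy using AddSubmonoid.closure_induction with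
  | mem x hx =>
    obtain ⟨i, rfl⟩ := hx
    refine ⟨Pi.single i 1, fun j => ?_, rfl⟩
    rw [Pi.single_apply]
    split_ifs <;> norm_num
  | zero => exact ⟨0, fun _ => le_rfl, rfl⟩
  | add x y _ _ hx hy =>
    obtain ⟨n, hn, rfl⟩ := hx
    obtain ⟨m, hm, rfl⟩ := hy
    exact ⟨n + m, fun i => add_nonneg (hn i) (hm i), rfl⟩

/-- Representative of `2c + kω`. -/
def repv (k : ℤ) : Fin 5 → ℤ := ![-k, -k, -k, -k, 2 + k]

theorem repv_eq (p k : ℤ) :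
    (2 : ℤ) • cel p + k • omg p = QuotientAddGroup.mk (repv k) := by
  have h : repv k = (2 : ℤ) • (Pi.single 4 1 : Fin 5 → ℤ) + k • ((Pi.single 4 1 : Fin 5 → ℤ)
      - Pi.single 0 1 - Pi.single 1 1 - Pi.single 2 1 - Pi.single 3 1) := by
    ext i
    fin_cases i <;> simp [repv, Pi.single_apply]
  rw [h]
  rfl

theorem bound_of_mem (p : ℤ) (hp : 2 ≤ p) (k : ℤ)
    (h : (2 : ℤ) • cel p + k • omg p ∈ Lplus p) : k ≤ 3 ∧ (0 < k → k = 2) := by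
  obtain ⟨n, hn, he⟩ := Lplus_rep p _ h
  rw [repv_eq, QuotientAddGroup.eq] at he
  obtain ⟨h0, h1, h2, h3⟩ := rels_inv p _ he
  simp [repv] at h0 h1 h2 h3
  have n0 := hn 0
  have n1 := hn 1
  have n2 := hn 2
  have n3 := hn 3
  have n4 := hn 4
  have m4 : 0 ≤ p * n 4 := by positivity
  have m0 : 0 ≤ p * n 0 := by positivity
  have m1 : 0 ≤ p * n 1 := by positivity
  have m2 : 0 ≤ p * n 2 := by positivity
  have hk : k ≤ 3 := by
    by_contra hc
    have : 4 ≤ k := by omega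
    nlinarith
  refine ⟨hk, fun hpos => ?_⟩
  by_contra hne
  have hodd : k = 1 ∨ k = 3 := by omega
  have q0 : 1 ≤ n 0 := by omega
  have q1 : 1 ≤ n 1 := by omega
  have q2 : 1 ≤ n 2 := by omega
  rcases hodd with rfl | rfl <;> nlinarith

theorem gen_mem (p : ℤ) (i : Fin 5) : gen p i ∈ Lplus p :=
  AddSubmonoid.subset_closure ⟨i, rfl⟩

theorem mem_of_rep (p : ℤ) (v n : Fin 5 → ℤ) (hn : ∀ i, 0 ≤ n i)
    (h : v - n ∈ AddSubgroup.closure (rels p)) :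
    (QuotientAddGroup.mk v : Lgrp p) ∈ Lplus p := by
  have e : (QuotientAddGroup.mk v : Lgrp p) = QuotientAddGroup.mk n := by
    rw [QuotientAddGroup.eq]
    have := neg_mem h
    rwa [neg_sub, sub_eq_neg_add] at this
  have e2 : (QuotientAddGroup.mk n : Lgrp p) = ∑ i, (n i).toNat • gen p i := by
    have : n = ∑ i, (n i).toNat • (Pi.single i 1 : Fin 5 → ℤ) := by
      ext j
      simp [Finset.sum_apply, Pi.single_apply, hn j]
    conv_lhs => rw [this]
    exact map_sum (QuotientAddGroup.mk' (AddSubgroup.closure (rels p))) _ _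
  rw [e, e2]
  exact sum_mem fun i _ => nsmul_mem (gen_mem p i) _

theorem rel_comb (p a b c d : ℤ) :
    (![2 * a, 2 * b, 2 * c, p * d, -a - b - c - d] : Fin 5 → ℤ) ∈
      AddSubgroup.closure (rels p) := by
  have e : (![2 * a, 2 * b, 2 * c, p * d, -a - b - c - d] : Fin 5 → ℤ) =
    a • ((2 : ℤ) • (Pi.single 0 1 : Fin 5 → ℤ) - Pi.single 4 1) +
    b • ((2 : ℤ) • (Pi.single 1 1 : Fin 5 → ℤ) - Pi.single 4 1) +
    c • ((2 : ℤ) • (Pi.single 2 1 : Fin 5 → ℤ) - Pi.single 4 1) +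
    d • (p • (Pi.single 3 1 : Fin 5 → ℤ) - Pi.single 4 1) := by
    ext i
    fin_cases i <;> simp [Pi.single_apply] <;> ring
  rw [e]
  refine add_mem (add_mem (add_mem ?_ ?_) ?_) ?_ <;>
    exact zsmul_mem (AddSubgroup.subset_closure (by simp [rels])) _

theorem mem_two (p : ℤ) (hp : 2 ≤ p) : (2 : ℤ) • cel p + (2 : ℤ) • omg p ∈ Lplus p := by
  rw [repv_eq]
  refine mem_of_rep p _ ![0, 0, 0, p - 2, 0] ?_ ?_
  · intro i
    fin_cases i <;> simp [hp]
  · convert rel_comb p (-1) (-1) (-1) (-1) using 1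
    ext i
    fin_cases i <;> simp [repv] <;> ring

theorem mem_nonpos (p : ℤ) (k : ℤ) (h1 : k ≤ 0) (h2 : -2 ≤ k) :
    (2 : ℤ) • cel p + k • omg p ∈ Lplus p := by
  rw [repv_eq]
  refine mem_of_rep p _ (repv k) ?_ ?_
  · intro i
    fin_cases i <;> simp [repv] <;> omega
  · rw [sub_self]
    exact zero_mem _

/-- For `ℓ ∈ ℤ`, `−2c ≤ ℓ·ω ≤ 2c` holds iff `ℓ ∈ {−2, 0, 2}`. -/
theorem stmt_5 (p : ℤ) (hp : 2 ≤ p) (l : ℤ) :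
    (Lle p (-((2 : ℤ) • cel p)) (l • omg p) ∧ Lle p (l • omg p) ((2 : ℤ) • cel p)) ↔
      (l = -2 ∨ l = 0 ∨ l = 2) := by
  have e1 : l • omg p - -((2 : ℤ) • cel p) = (2 : ℤ) • cel p + l • omg p := by abel
  have e2 : (2 : ℤ) • cel p - l • omg p = (2 : ℤ) • cel p + (-l) • omg p := by
    rw [neg_smul, sub_eq_add_neg]
  unfold Lle
  rw [e1, e2]
  constructor
  · rintro ⟨ha, hb⟩
    have := bound_of_mem p hp _ ha
    have := bound_of_mem p hp _ hb
    omega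
  · rintro (rfl | rfl | rfl)
    · exact ⟨mem_nonpos p _ (by norm_num) (by norm_num), mem_two p hp⟩
    · exact ⟨mem_nonpos p _ (by norm_num) (by norm_num),
        mem_nonpos p _ (by norm_num) (by norm_num)⟩
    · exact ⟨mem_two p hp, mem_nonpos p _ (by norm_num) (by norm_num)⟩
end
end

section
/- For an element y ∈ L, the three conditions (−2c ≤ y ≤ 2c), (−2c ≤ y − 2ω ≤ 2c) and (−2c ≤ y + 2ω ≤ 2c) hold simultaneously if and only if −(p−2)·x₄ ≤ y ≤ (p−2)·x₄. -/
noncomputable section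

theorem gen_rel_aux (p k : ℤ) (i : Fin 5)
    (h : k • (Pi.single i 1 : Fin 5 → ℤ) - Pi.single 4 1 ∈ rels p) :
    k • gen p i = cel p := by
  have h1 : (QuotientAddGroup.mk (k • (Pi.single i 1 : Fin 5 → ℤ) - Pi.single 4 1) : Lgrp p) = 0 :=
    (QuotientAddGroup.eq_zero_iff _).2 (AddSubgroup.subset_closure h)
  exact sub_eq_zero.1 h1

/-- For `y ∈ L`, the three conditions `−2c ≤ y ≤ 2c`, `−2c ≤ y − 2ω ≤ 2c` and
`−2c ≤ y + 2ω ≤ 2c` hold simultaneously iff `−(p−2)·x₄ ≤ y ≤ (p−2)·x₄`. -/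
theorem stmt_8 (p : ℤ) (hp : 2 ≤ p) (y : Lgrp p) :
    ((Lle p (-((2 : ℤ) • cel p)) y ∧ Lle p y ((2 : ℤ) • cel p)) ∧
     (Lle p (-((2 : ℤ) • cel p)) (y - (2 : ℤ) • omg p) ∧
        Lle p (y - (2 : ℤ) • omg p) ((2 : ℤ) • cel p)) ∧
     (Lle p (-((2 : ℤ) • cel p)) (y + (2 : ℤ) • omg p) ∧
        Lle p (y + (2 : ℤ) • omg p) ((2 : ℤ) • cel p))) ↔
      (Lle p (-((p - 2) • gen p 3)) y ∧ Lle p y ((p - 2) • gen p 3)) := by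
  have h0 : (2 : ℤ) • gen p 0 = cel p := gen_rel_aux p 2 0 (by simp [rels])
  have h1 : (2 : ℤ) • gen p 1 = cel p := gen_rel_aux p 2 1 (by simp [rels])
  have h2 : (2 : ℤ) • gen p 2 = cel p := gen_rel_aux p 2 2 (by simp [rels])
  have h3 : p • gen p 3 = cel p := gen_rel_aux p p 3 (by simp [rels])
  have hw : (2 : ℤ) • omg p = -cel p - (2 : ℤ) • gen p 3 := by
    unfold omg
    rw [zsmul_sub, zsmul_sub, zsmul_sub, zsmul_sub, h0, h1, h2]
    abel
  have hq : (p - 2) • gen p 3 = cel p - (2 : ℤ) • gen p 3 := by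
    rw [sub_smul, h3]
  have mc : cel p ∈ Lplus p := AddSubmonoid.subset_closure ⟨4, rfl⟩
  have mx : gen p 3 ∈ Lplus p := AddSubmonoid.subset_closure ⟨3, rfl⟩
  have m1 : cel p + gen p 3 + gen p 3 ∈ Lplus p := add_mem (add_mem mc mx) mx
  have m2 := add_mem m1 m1
  unfold Lle
  rw [hw, hq]
  generalize cel p = c at *
  generalize gen p 3 = x at *
  constructor
  · rintro ⟨-, ⟨-, ha⟩, ⟨hb, -⟩⟩
    constructor
    · convert hb using 1
      abel
    · convert ha using 1
      abel
  · rintro ⟨ha, hb⟩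
    refine ⟨⟨?_, ?_⟩, ⟨?_, ?_⟩, ⟨?_, ?_⟩⟩
    · convert add_mem ha m1 using 1
      abel
    · convert add_mem hb m1 using 1
      abel
    · convert add_mem ha m2 using 1
      abel
    · convert hb using 1
      abel
    · convert ha using 1
      abel
    · convert add_mem hb m2 using 1
      abel
end
end

section
/- Let x₀ ∈ L and let V := {x₀ + g + ℓ·ω : g ∈ G, ℓ ∈ {0,1,2}} ⊆ L (a (ω,2)-segment). If M ⊆ V satisfies −2c ≤ y − x ≤ 2c for all x, y ∈ M, then M has at most 5 elements. -/
noncomputable section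

lemma closure_rep (p : ℤ) (v : Fin 5 → ℤ) (hv : v ∈ AddSubgroup.closure (rels p)) :
    ∃ a b c d : ℤ, v 0 = 2 * a ∧ v 1 = 2 * b ∧ v 2 = 2 * c ∧ v 3 = p * d ∧
      v 4 = -a - b - c - d := by
  induction hv using AddSubgroup.closure_induction with
  | mem x hx =>
    simp only [rels, Set.mem_insert_iff, Set.mem_singleton_iff] at hx
    rcases hx with rfl | rfl | rfl | rfl
    · exact ⟨1, 0, 0, 0, by simp [Pi.single_apply]⟩
    · exact ⟨0, 1, 0, 0, by simp [Pi.single_apply]⟩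
    · exact ⟨0, 0, 1, 0, by simp [Pi.single_apply]⟩
    · exact ⟨0, 0, 0, 1, by simp [Pi.single_apply]⟩
  | zero => exact ⟨0, 0, 0, 0, by simp⟩
  | add x y _ _ hx hy =>
    obtain ⟨a, b, c, d, h0, h1, h2, h3, h4⟩ := hx
    obtain ⟨a', b', c', d', h0', h1', h2', h3', h4'⟩ := hy
    refine ⟨a + a', b + b', c + c', d + d', ?_, ?_, ?_, ?_, ?_⟩ <;>
      simp only [Pi.add_apply, *] <;> ring
  | neg x _ hx =>
    obtain ⟨a, b, c, d, h0, h1, h2, h3, h4⟩ := hx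
    refine ⟨-a, -b, -c, -d, ?_, ?_, ?_, ?_, ?_⟩ <;>
      simp only [Pi.neg_apply, *] <;> ring

lemma plus_rep (p : ℤ) (z : Lgrp p) (hz : z ∈ Lplus p) :
    ∃ w : Fin 5 → ℤ, (∀ i, 0 ≤ w i) ∧ z = QuotientAddGroup.mk w := by
  unfold Lplus at hz
  induction hz using AddSubmonoid.closure_induction with
  | mem x hx =>
    obtain ⟨i, rfl⟩ := hx
    refine ⟨Pi.single i 1, fun j => ?_, rfl⟩
    rw [Pi.single_apply]; split_ifs <;> norm_num
  | zero => exact ⟨0, fun _ => le_rfl, rfl⟩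
  | add x y _ _ hx hy =>
    obtain ⟨w, hw, rfl⟩ := hx
    obtain ⟨w', hw', rfl⟩ := hy
    exact ⟨w + w', fun i => add_nonneg (hw i) (hw' i), rfl⟩

lemma plus_ineq (p : ℤ) (hp : 2 ≤ p) (v : Fin 5 → ℤ) (h3 : v 3 < 0)
    (hv : (QuotientAddGroup.mk v : Lgrp p) ∈ Lplus p) :
    ∃ a b c d : ℤ, 0 ≤ v 0 + 2 * a ∧ 0 ≤ v 1 + 2 * b ∧ 0 ≤ v 2 + 2 * c ∧ 1 ≤ d ∧
      0 ≤ v 4 - a - b - c - d := by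
  obtain ⟨w, hw, e⟩ := plus_rep p _ hv
  rw [QuotientAddGroup.eq] at e
  obtain ⟨a, b, c, d, e0, e1, e2, e3, e4⟩ := closure_rep p _ e
  simp only [Pi.add_apply, Pi.neg_apply] at e0 e1 e2 e3 e4
  have := hw 0
  have := hw 1
  have := hw 2
  have := hw 3
  have := hw 4
  refine ⟨a, b, c, d, by omega, by omega, by omega, ?_, by omega⟩
  by_contra hd
  have : p * d ≤ 0 := by nlinarith
  omega

/-- Lifts of the elements of `G`. -/
def gLift (i : Fin 4) : Fin 5 → ℤ :=
  ![![0, 0, 0, 0, 0], ![1, -1, 0, 0, 0], ![1, 0, -1, 0, 0], ![0, 1, -1, 0, 0]] i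

/-- Lift of `ω`. -/
def oLift : Fin 5 → ℤ := ![-1, -1, -1, -1, 1]

lemma oLift_eq (p : ℤ) : omg p = QuotientAddGroup.mk oLift := by
  have : oLift = Pi.single 4 1 - Pi.single 0 1 - Pi.single 1 1 - Pi.single 2 1
      - Pi.single 3 1 := by decide
  rw [this]; rfl

lemma cLift_eq (p : ℤ) : (2 : ℤ) • cel p = QuotientAddGroup.mk ![0, 0, 0, 0, 2] := by
  have : (![0, 0, 0, 0, 2] : Fin 5 → ℤ) = (2 : ℤ) • Pi.single 4 1 := by decide
  rw [this]; rfl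

lemma gLift_ex (p : ℤ) (g : Lgrp p) (hg : g ∈ Gset p) :
    ∃ i, g = QuotientAddGroup.mk (gLift i) := by
  simp only [Gset, Set.mem_insert_iff, Set.mem_singleton_iff] at hg
  rcases hg with rfl | rfl | rfl | rfl
  · refine ⟨0, ?_⟩
    have : gLift 0 = 0 := by decide
    rw [this]; rfl
  · refine ⟨1, ?_⟩
    have : gLift 1 = Pi.single 0 1 - Pi.single 1 1 := by decide
    rw [this]; rfl
  · refine ⟨2, ?_⟩
    have : gLift 2 = Pi.single 0 1 - Pi.single 2 1 := by decide
    rw [this]; rfl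
  · refine ⟨3, ?_⟩
    have : gLift 3 = Pi.single 1 1 - Pi.single 2 1 := by decide
    rw [this]; rfl

/-- The element of the segment with indices `i` and `l`. -/
def seg (p : ℤ) (x₀ : Lgrp p) (q : Fin 4 × Fin 3) : Lgrp p :=
  x₀ + QuotientAddGroup.mk (gLift q.1) + ((q.2.val : ℕ) : ℤ) • omg p

lemma diff_ineq (p : ℤ) (hp : 2 ≤ p) (x₀ : Lgrp p) (i j : Fin 4) (k l : Fin 3) (hkl : k < l)
    (h : Lle p (-((2 : ℤ) • cel p)) (seg p x₀ (j, l) - seg p x₀ (i, k)))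
    (v : Fin 5 → ℤ)
    (hv : v = gLift j - gLift i + ((l.val : ℤ) - (k.val : ℤ)) • oLift + ![0, 0, 0, 0, 2]) :
    ∃ a b c d : ℤ, 0 ≤ v 0 + 2 * a ∧ 0 ≤ v 1 + 2 * b ∧ 0 ≤ v 2 + 2 * c ∧ 1 ≤ d ∧
      0 ≤ v 4 - a - b - c - d := by
  apply plus_ineq p hp
  · subst hv
    revert i j k l
    have : ∀ i j : Fin 4, ∀ k l : Fin 3, k < l →
      (gLift j - gLift i + ((l.val : ℤ) - (k.val : ℤ)) • oLift + ![0, 0, 0, 0, 2] : Fin 5 → ℤ) 3 < 0 := by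
      decide
    intro i j k l hkl _
    exact this i j k l hkl
  · have e : (QuotientAddGroup.mk v : Lgrp p) =
        seg p x₀ (j, l) - seg p x₀ (i, k) - (-((2 : ℤ) • cel p)) := by
      rw [hv, cLift_eq]
      simp only [seg, oLift_eq]
      have : (QuotientAddGroup.mk (gLift j - gLift i + ((l.val : ℤ) - (k.val : ℤ)) • oLift
          + ![0, 0, 0, 0, 2]) : Lgrp p) = QuotientAddGroup.mk (gLift j)
          - QuotientAddGroup.mk (gLift i)
          + ((l.val : ℤ) - (k.val : ℤ)) • QuotientAddGroup.mk oLift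
          + QuotientAddGroup.mk ![0, 0, 0, 0, 2] := rfl
      rw [this, sub_smul]
      abel
    rw [e]
    exact h

lemma not_one (p : ℤ) (hp : 2 ≤ p) (x₀ : Lgrp p) (i : Fin 4) (k l : Fin 3)
    (hkl : (l : ℕ) = k + 1)
    (h : Lle p (-((2 : ℤ) • cel p)) (seg p x₀ (i, l) - seg p x₀ (i, k))) : False := by
  obtain ⟨a, b, c, d, h0, h1, h2, h3, h4⟩ := diff_ineq p hp x₀ i i k l (by omega) h
    ![-1, -1, -1, -1, 3] (by
      have : ((l.val : ℤ) - (k.val : ℤ)) = 1 := by omega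
      rw [this, sub_self]; decide)
  simp at h0 h1 h2 h4
  omega

lemma not_two (p : ℤ) (hp : 2 ≤ p) (x₀ : Lgrp p) (i j : Fin 4) (hij : i ≠ j)
    (h : Lle p (-((2 : ℤ) • cel p)) (seg p x₀ (j, 2) - seg p x₀ (i, 0))) : False := by
  obtain ⟨a, b, c, d, h0, h1, h2, h3, h4⟩ := diff_ineq p hp x₀ i j 0 2 (by decide) h _ rfl
  fin_cases i <;> fin_cases j <;> simp [gLift, oLift] at hij h0 h1 h2 h4 <;> omega

lemma count (f : Fin 4 × Fin 3 → ℕ) (h1 : ∀ q, f q ≤ 1)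
    (ha : ∀ i, f (i, 0) + f (i, 1) ≤ 1) (hb : ∀ i, f (i, 1) + f (i, 2) ≤ 1)
    (hc : ∀ i j, i ≠ j → f (i, 0) + f (j, 2) ≤ 1) : ∑ q, f q ≤ 5 := by
  rw [Fintype.sum_prod_type]
  simp only [Fin.sum_univ_succ, Fin.sum_univ_zero, Fin.forall_fin_succ] at *
  simp at *
  by_cases c0 : f (0, 2) = 0 <;> by_cases c1 : f (1, 2) = 0 <;>
    by_cases c2 : f (2, 2) = 0 <;> by_cases c3 : f (3, 2) = 0 <;> omega

/-- If `M` is a subset of a `(ω,2)`-segment `{x₀ + g + ℓ·ω : g ∈ G, ℓ ∈ {0,1,2}}` such that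
`−2c ≤ y − x ≤ 2c` for all `x, y ∈ M`, then `M` has at most `5` elements. -/
theorem stmt_10 (p : ℤ) (hp : 2 ≤ p) (x₀ : Lgrp p) (M : Set (Lgrp p))
    (hM : M ⊆ {z | ∃ g ∈ Gset p, ∃ l : ℤ, (l = 0 ∨ l = 1 ∨ l = 2) ∧ z = x₀ + g + l • omg p})
    (hrig : ∀ x ∈ M, ∀ y ∈ M,
      Lle p (-((2 : ℤ) • cel p)) (y - x) ∧ Lle p (y - x) ((2 : ℤ) • cel p)) :
    M.Finite ∧ M.ncard ≤ 5 := by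
  classical
  let S : Finset (Fin 4 × Fin 3) := Finset.univ.filter (fun q => seg p x₀ q ∈ M)
  have hS : M ⊆ (seg p x₀) '' (S : Set (Fin 4 × Fin 3)) := by
    intro z hz
    obtain ⟨g, hg, l, hl, e⟩ := hM hz
    obtain ⟨i, rfl⟩ := gLift_ex p g hg
    have : ∃ k : Fin 3, l = ((k : ℕ) : ℤ) := by
      rcases hl with rfl | rfl | rfl
      · exact ⟨0, rfl⟩
      · exact ⟨1, rfl⟩
      · exact ⟨2, rfl⟩
    obtain ⟨k, rfl⟩ := this
    have e' : seg p x₀ (i, k) = z := e.symm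
    refine ⟨(i, k), ?_, e'⟩
    simp only [S, Finset.coe_filter, Finset.mem_univ, true_and, Set.mem_ofPred_eq]
    rw [e']; exact hz
  have hfin : ((seg p x₀) '' (S : Set (Fin 4 × Fin 3))).Finite := S.finite_toSet.image _
  refine ⟨hfin.subset hS, ?_⟩
  calc M.ncard ≤ ((seg p x₀) '' (S : Set (Fin 4 × Fin 3))).ncard := Set.ncard_le_ncard hS hfin
    _ ≤ (S : Set (Fin 4 × Fin 3)).ncard := Set.ncard_image_le S.finite_toSet
    _ = S.card := Set.ncard_coe_finset S
    _ = ∑ q, if seg p x₀ q ∈ M then 1 else 0 := Finset.card_filter _ _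
    _ ≤ 5 := by
      apply count
      · intro q; split_ifs <;> omega
      · intro i
        split_ifs with h h'
        · exact (not_one p hp x₀ i 0 1 rfl (hrig _ h _ h').1).elim
        all_goals omega
      · intro i
        split_ifs with h h'
        · exact (not_one p hp x₀ i 1 2 rfl (hrig _ h _ h').1).elim
        all_goals omega
      · intro i j hij
        split_ifs with h h'
        · exact (not_two p hp x₀ i j hij (hrig _ h _ h').1).elim
        all_goals omega
end
end

section
/- Let i, j, k_i, k_j be integers with 0 ≤ i ≤ j ≤ p − 2, k_j ≤ k_i and i + k_i ≤ j + k_j. Define D := {ω + n·x₄ + g : n ∈ ℤ, j + k_j − p + 1 ≤ n ≤ k_j + p, g ∈ G} ∪ {n·x₄ + g : n ∈ ℤ, k_i − p − 1 ≤ n ≤ i + k_i, g ∈ G} ⊆ L. If M ⊆ D satisfies −2c ≤ y − x ≤ 2c for all x, y ∈ M, then M has at most 5p + i − j + 6 elements. -/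
noncomputable section

def vfl (p : ℤ) (v : Fin 5 → ℤ) : ℤ := v 0 / 2 + v 1 / 2 + v 2 / 2 + v 3 / p + v 4

lemma rels_form (p : ℤ) (v : Fin 5 → ℤ) (hv : v ∈ AddSubgroup.closure (rels p)) :
    ∃ a b c d : ℤ, v 0 = a * 2 ∧ v 1 = b * 2 ∧ v 2 = c * 2 ∧ v 3 = d * p ∧
      v 4 = -a - b - c - d := by
  induction hv using AddSubgroup.closure_induction with
  | mem x hx =>
    simp only [rels, Set.mem_insert_iff, Set.mem_singleton_iff] at hx
    rcases hx with rfl | rfl | rfl | rfl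
    · exact ⟨1, 0, 0, 0, by simp⟩
    · exact ⟨0, 1, 0, 0, by simp⟩
    · exact ⟨0, 0, 1, 0, by simp⟩
    · exact ⟨0, 0, 0, 1, by simp⟩
  | zero => exact ⟨0, 0, 0, 0, by simp⟩
  | add x y _ _ hx hy =>
    obtain ⟨a, b, c, d, h0, h1, h2, h3, h4⟩ := hx
    obtain ⟨a', b', c', d', h0', h1', h2', h3', h4'⟩ := hy
    refine ⟨a + a', b + b', c + c', d + d', ?_, ?_, ?_, ?_, ?_⟩ <;>
      simp only [Pi.add_apply, *] <;> ring
  | neg x _ hx =>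
    obtain ⟨a, b, c, d, h0, h1, h2, h3, h4⟩ := hx
    refine ⟨-a, -b, -c, -d, ?_, ?_, ?_, ?_, ?_⟩ <;>
      simp only [Pi.neg_apply, *] <;> ring

lemma Lplus_form (p : ℤ) (x : Lgrp p) (hx : x ∈ Lplus p) :
    ∃ w : Fin 5 → ℤ, (∀ k, 0 ≤ w k) ∧ (QuotientAddGroup.mk w : Lgrp p) = x := by
  unfold Lplus at hx
  induction hx using AddSubmonoid.closure_induction with
  | mem x hx =>
    obtain ⟨k, rfl⟩ := hx
    refine ⟨Pi.single k 1, fun l => ?_, rfl⟩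
    rw [Pi.single_apply]; split_ifs <;> norm_num
  | zero => exact ⟨0, fun _ => le_rfl, rfl⟩
  | add x y _ _ hx hy =>
    obtain ⟨w, hw, rfl⟩ := hx
    obtain ⟨w', hw', rfl⟩ := hy
    exact ⟨w + w', fun k => add_nonneg (hw k) (hw' k), rfl⟩

lemma vfl_nonneg (p : ℤ) (hp : 2 ≤ p) (v : Fin 5 → ℤ)
    (hv : (QuotientAddGroup.mk v : Lgrp p) ∈ Lplus p) : 0 ≤ vfl p v := by
  obtain ⟨w, hw, he⟩ := Lplus_form p _ hv
  rw [QuotientAddGroup.eq] at he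
  obtain ⟨a, b, c, d, h0, h1, h2, h3, h4⟩ := rels_form p _ he
  simp only [Pi.add_apply, Pi.neg_apply] at h0 h1 h2 h3 h4
  have e3 : v 3 = w 3 + d * p := by linarith
  have := hw 0
  have := hw 1
  have := hw 2
  have := hw 4
  have h5 : 0 ≤ w 3 / p := Int.ediv_nonneg (hw 3) (by omega)
  have h6 : v 3 / p = w 3 / p + d := by
    rw [e3, Int.add_mul_ediv_right _ _ (by omega)]
  unfold vfl
  omega

/-- representatives of the elements of `G` -/
def gv (k : Fin 4) : Fin 5 → ℤ :=
  ![![0,0,0,0,0], ![1,-1,0,0,0], ![1,0,-1,0,0], ![0,1,-1,0,0]] k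

def elB (p n : ℤ) (k : Fin 4) : Lgrp p :=
  QuotientAddGroup.mk (gv k + ![0,0,0,n,0])

def elA (p n : ℤ) (k : Fin 4) : Lgrp p :=
  QuotientAddGroup.mk (gv k + ![-1,-1,-1,n-1,1])

lemma G_form (p : ℤ) (g : Lgrp p) (hg : g ∈ Gset p) :
    ∃ k, g = QuotientAddGroup.mk (gv k) := by
  simp only [Gset, Set.mem_insert_iff, Set.mem_singleton_iff] at hg
  rcases hg with rfl | rfl | rfl | rfl
  · refine ⟨0, ?_⟩
    have : gv 0 = 0 := by ext l; fin_cases l <;> rfl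
    rw [this]; rfl
  · refine ⟨1, ?_⟩
    have : gv 1 = Pi.single 0 1 - Pi.single 1 1 := by
      ext l; fin_cases l <;> simp [gv]
    rw [this]; rfl
  · refine ⟨2, ?_⟩
    have : gv 2 = Pi.single 0 1 - Pi.single 2 1 := by
      ext l; fin_cases l <;> simp [gv]
    rw [this]; rfl
  · refine ⟨3, ?_⟩
    have : gv 3 = Pi.single 1 1 - Pi.single 2 1 := by
      ext l; fin_cases l <;> simp [gv]
    rw [this]; rfl

lemma elB_eq (p n : ℤ) (k : Fin 4) :
    n • gen p 3 + QuotientAddGroup.mk (gv k) = elB p n k := by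
  have : (![0,0,0,n,0] : Fin 5 → ℤ) = n • Pi.single 3 1 := by
    ext l; fin_cases l <;> simp
  unfold elB
  rw [this, add_comm (gv k)]; rfl

lemma elA_eq (p n : ℤ) (k : Fin 4) :
    omg p + n • gen p 3 + QuotientAddGroup.mk (gv k) = elA p n k := by
  have : (![-1,-1,-1,n-1,1] : Fin 5 → ℤ) = Pi.single 4 1 - Pi.single 0 1 - Pi.single 1 1
      - Pi.single 2 1 - Pi.single 3 1 + n • Pi.single 3 1 := by
    ext l; fin_cases l <;> simp
    ring
  unfold elA
  rw [this, add_comm (gv k)]; rfl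

lemma Lle_vfl (p : ℤ) (hp : 2 ≤ p) (v w : Fin 5 → ℤ)
    (h : Lle p (-((2 : ℤ) • cel p))
      ((QuotientAddGroup.mk w : Lgrp p) - (QuotientAddGroup.mk v : Lgrp p))) :
    0 ≤ vfl p (w - v + ![0,0,0,0,2]) := by
  apply vfl_nonneg p hp
  have h2 : (![0,0,0,0,2] : Fin 5 → ℤ) = (2 : ℤ) • Pi.single 4 1 := by
    ext l; fin_cases l <;> simp
  unfold Lle at h
  rw [sub_neg_eq_add] at h
  rw [h2]; exact h

lemma ediv_ge {p d c : ℤ} (hp : 2 ≤ p) (h : c ≤ d / p) : c * p ≤ d :=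
  (Int.le_ediv_iff_mul_le (by omega)).1 h

lemma gv_diff (k l : Fin 4) (h : k ≠ l) :
    (gv l 0 - gv k 0) / 2 + (gv l 1 - gv k 1) / 2 + (gv l 2 - gv k 2) / 2 = -1 := by
  revert h; revert k l; unfold gv; decide

lemma gv3 (k : Fin 4) : gv k 3 = 0 := by fin_cases k <;> rfl
lemma gv4 (k : Fin 4) : gv k 4 = 0 := by fin_cases k <;> rfl

lemma condB (p : ℤ) (hp : 2 ≤ p) (n m : ℤ) (k l : Fin 4) (hkl : k ≠ l)
    (h : Lle p (-((2 : ℤ) • cel p)) (elB p m l - elB p n k)) : n - m ≤ p := by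
  have := Lle_vfl p hp _ _ h
  have hd := gv_diff k l hkl
  simp only [vfl, Pi.add_apply, Pi.sub_apply, gv3, gv4] at this
  simp at this
  have := ediv_ge (c := -1) (d := m - n) hp (by linarith)
  linarith

lemma condA (p : ℤ) (hp : 2 ≤ p) (n m : ℤ) (k l : Fin 4) (hkl : k ≠ l)
    (h : Lle p (-((2 : ℤ) • cel p)) (elA p m l - elA p n k)) : n - m ≤ p := by
  have := Lle_vfl p hp _ _ h
  have hd := gv_diff k l hkl
  simp only [vfl, Pi.add_apply, Pi.sub_apply, gv3, gv4] at this
  simp at this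
  have := ediv_ge (c := -1) (d := m - n) hp (by linarith)
  linarith

lemma condAB (p : ℤ) (hp : 2 ≤ p) (n m : ℤ) (k : Fin 4)
    (h : Lle p (-((2 : ℤ) • cel p)) (elA p n k - elB p m k)) : 1 ≤ n - m := by
  have := Lle_vfl p hp _ _ h
  simp [vfl] at this
  have := ediv_ge (c := 0) (d := n - 1 - m) hp (by linarith)
  linarith

lemma condBA (p : ℤ) (hp : 2 ≤ p) (n m : ℤ) (k : Fin 4)
    (h : Lle p (-((2 : ℤ) • cel p)) (elB p m k - elA p n k)) : n - m ≤ p + 1 := by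
  have := Lle_vfl p hp _ _ h
  simp [vfl] at this
  have := ediv_ge (c := -1) (d := m - (n - 1)) hp (by linarith)
  linarith

lemma card_spread (S : Finset ℤ) (q : ℤ) (hq : 0 ≤ q) (h : ∀ x ∈ S, ∀ y ∈ S, y - x ≤ q) :
    (S.card : ℤ) ≤ q + 1 := by
  rcases S.eq_empty_or_nonempty with rfl | hS
  · simp; omega
  · have hsub : S ⊆ Finset.Icc (S.min' hS) (S.min' hS + q) := fun x hx => by
      have := h _ (S.min'_mem hS) x hx
      have := S.min'_le x hx
      rw [Finset.mem_Icc]; omega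
    have := Finset.card_le_card hsub
    rw [Int.card_Icc] at this
    omega

lemma card_mm (S : Finset ℤ) (hS : S.Nonempty) :
    (S.card : ℤ) ≤ S.max' hS - S.min' hS + 1 := by
  apply card_spread
  · have := S.min'_le _ (S.max'_mem hS); omega
  · intro x hx y hy
    have := S.min'_le x hx
    have := S.le_max' y hy
    omega

open Classical in
lemma per_g (p i j a b : ℤ) (hp : 2 ≤ p) (hi : 0 ≤ i) (hj : j ≤ p - 2) (A B : Finset ℤ)
    (hA : ∀ x ∈ A, a ≤ x ∧ x ≤ a + (2 * p - j - 1)) (hB : ∀ x ∈ B, b ≤ x ∧ x ≤ b + (p + i + 1))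
    (hAB : ∀ n ∈ A, ∀ m ∈ B, 1 ≤ n - m ∧ n - m ≤ p + 1) :
    (A.card : ℤ) + B.card ≤ p + 2 + (if ∃ x ∈ A, ∃ y ∈ A, p < y - x then p - 2 - j else 0)
      + (if ∃ x ∈ B, ∃ y ∈ B, p < y - x then i else 0) := by
  rcases A.eq_empty_or_nonempty with rfl | hAn
  · simp only [Finset.card_empty, Finset.notMem_empty, false_and, exists_false, if_false]
    split_ifs with h
    · have := card_spread B (p + i + 1) (by omega) (fun x hx y hy => by
        have := hB x hx
        have := hB y hy
        omega)
      push_cast; omega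
    · push Not at h
      have := card_spread B p (by omega) h
      push_cast; omega
  · rcases B.eq_empty_or_nonempty with rfl | hBn
    · simp only [Finset.card_empty, Finset.notMem_empty, false_and, exists_false, if_false]
      split_ifs with h
      · have := card_spread A (2 * p - j - 1) (by omega) (fun x hx y hy => by
          have := hA x hx
          have := hA y hy
          omega)
        push_cast; omega
      · push Not at h
        have := card_spread A p (by omega) h
        push_cast; omega
    · have h1 := card_mm A hAn
      have h2 := card_mm B hBn
      have h3 := hAB _ (A.max'_mem hAn) _ (B.min'_mem hBn)
      have h4 := hAB _ (A.min'_mem hAn) _ (B.max'_mem hBn)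
      split_ifs <;> omega

lemma sum_ite_le (P : Fin 4 → Prop) [DecidablePred P] (c : ℤ) (hc : 0 ≤ c)
    (h : ∀ k l, P k → P l → k = l) : ∑ k, (if P k then c else 0) ≤ c := by
  by_cases hP : ∃ k, P k
  · obtain ⟨k, hk⟩ := hP
    rw [Finset.sum_eq_single k]
    · simp [hk]
    · intro l _ hl
      rw [if_neg]
      exact fun h' => hl (h l k h' hk)
    · simp
  · push Not at hP
    simp [hP, hc]

lemma big_unique (p : ℤ) (A : Fin 4 → Finset ℤ)
    (h : ∀ k l, k ≠ l → ∀ n ∈ A k, ∀ m ∈ A l, n - m ≤ p) (k l : Fin 4)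
    (hk : ∃ x ∈ A k, ∃ y ∈ A k, p < y - x) (hl : ∃ x ∈ A l, ∃ y ∈ A l, p < y - x) : k = l := by
  by_contra hkl
  obtain ⟨x, hx, y, hy, hxy⟩ := hk
  obtain ⟨z, hz, w, hw, hzw⟩ := hl
  have := h k l hkl y hy z hz
  have := h l k (Ne.symm hkl) w hw x hx
  omega

/-- With `D` as in the rigid-domain description, any `M ⊆ D` with `−2c ≤ y − x ≤ 2c`
for all `x, y ∈ M` has at most `5p + i − j + 6` elements. -/
theorem stmt_13 (p : ℤ) (hp : 2 ≤ p) (i j ki kj : ℤ)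
    (hi : 0 ≤ i) (hij : i ≤ j) (hj : j ≤ p - 2) (hk1 : kj ≤ ki) (hk2 : i + ki ≤ j + kj)
    (D : Set (Lgrp p))
    (hD : D = {z | ∃ n : ℤ, j + kj - p + 1 ≤ n ∧ n ≤ kj + p ∧
                    ∃ g ∈ Gset p, z = omg p + n • gen p 3 + g}
             ∪ {z | ∃ n : ℤ, ki - p - 1 ≤ n ∧ n ≤ i + ki ∧
                    ∃ g ∈ Gset p, z = n • gen p 3 + g})
    (M : Set (Lgrp p)) (hMD : M ⊆ D)
    (hrig : ∀ x ∈ M, ∀ y ∈ M,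
      Lle p (-((2 : ℤ) • cel p)) (y - x) ∧ Lle p (y - x) ((2 : ℤ) • cel p)) :
    M.Finite ∧ (M.ncard : ℤ) ≤ 5 * p + i - j + 6 := by
  classical
  set a := j + kj - p + 1 with ha
  set b := ki - p - 1 with hb
  let A : Fin 4 → Finset ℤ := fun k => (Finset.Icc a (a + (2 * p - j - 1))).filter
    (fun n => elA p n k ∈ M)
  let B : Fin 4 → Finset ℤ := fun k => (Finset.Icc b (b + (p + i + 1))).filter
    (fun n => elB p n k ∈ M)
  let T : Finset (Lgrp p) := Finset.univ.biUnion
    (fun k => (A k).image (fun n => elA p n k) ∪ (B k).image (fun n => elB p n k))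
  have hMT : M ⊆ (T : Set (Lgrp p)) := by
    intro z hz
    have hzD := hMD hz
    rw [hD] at hzD
    simp only [T, Finset.coe_biUnion, Set.mem_iUnion, Finset.mem_coe, Finset.mem_union,
      Finset.mem_image]
    rcases hzD with ⟨n, h1, h2, g, hg, rfl⟩ | ⟨n, h1, h2, g, hg, rfl⟩
    · obtain ⟨k, rfl⟩ := G_form p g hg
      rw [elA_eq] at hz ⊢
      exact ⟨k, Finset.mem_univ _, Or.inl ⟨n, Finset.mem_filter.2
        ⟨Finset.mem_Icc.2 ⟨by omega, by omega⟩, hz⟩, rfl⟩⟩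
    · obtain ⟨k, rfl⟩ := G_form p g hg
      rw [elB_eq] at hz ⊢
      exact ⟨k, Finset.mem_univ _, Or.inr ⟨n, Finset.mem_filter.2
        ⟨Finset.mem_Icc.2 ⟨by omega, by omega⟩, hz⟩, rfl⟩⟩
  refine ⟨T.finite_toSet.subset hMT, ?_⟩
  have hc1 : M.ncard ≤ T.card := by
    rw [← Set.ncard_coe_finset]
    exact Set.ncard_le_ncard hMT T.finite_toSet
  have hc2 : T.card ≤ ∑ k, ((A k).card + (B k).card) := by
    refine Finset.card_biUnion_le.trans (Finset.sum_le_sum fun k _ => ?_)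
    exact (Finset.card_union_le _ _).trans
      (add_le_add Finset.card_image_le Finset.card_image_le)
  have mA : ∀ k, ∀ n ∈ A k, (a ≤ n ∧ n ≤ a + (2 * p - j - 1)) ∧ elA p n k ∈ M := by
    intro k n hn
    have := Finset.mem_filter.1 hn
    exact ⟨Finset.mem_Icc.1 this.1, this.2⟩
  have mB : ∀ k, ∀ n ∈ B k, (b ≤ n ∧ n ≤ b + (p + i + 1)) ∧ elB p n k ∈ M := by
    intro k n hn
    have := Finset.mem_filter.1 hn
    exact ⟨Finset.mem_Icc.1 this.1, this.2⟩
  have hper := fun k => per_g p i j a b hp hi hj (A k) (B k)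
    (fun x hx => (mA k x hx).1) (fun x hx => (mB k x hx).1)
    (fun n hn m hm => ⟨condAB p hp n m k (hrig _ (mB k m hm).2 _ (mA k n hn).2).1,
      condBA p hp n m k (hrig _ (mA k n hn).2 _ (mB k m hm).2).1⟩)
  have uA := sum_ite_le (fun k => ∃ x ∈ A k, ∃ y ∈ A k, p < y - x) (p - 2 - j) (by omega)
    (big_unique p A fun k l hkl n hn m hm =>
      condA p hp n m k l hkl (hrig _ (mA k n hn).2 _ (mA l m hm).2).1)
  have uB := sum_ite_le (fun k => ∃ x ∈ B k, ∃ y ∈ B k, p < y - x) i hi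
    (big_unique p B fun k l hkl n hn m hm =>
      condB p hp n m k l hkl (hrig _ (mB k n hn).2 _ (mB l m hm).2).1)
  have hs := Finset.sum_le_sum (fun k (_ : k ∈ (Finset.univ : Finset (Fin 4))) => hper k)
  rw [Finset.sum_add_distrib (f := fun k => p + 2 + _), Finset.sum_add_distrib (f := fun _ => p + 2)] at hs
  have hc3 : (M.ncard : ℤ) ≤ ∑ k, (((A k).card : ℤ) + (B k).card) := by
    exact_mod_cast hc1.trans hc2
  have h4 : ∑ _k : Fin 4, (p + 2) = 4 * (p + 2) := by simp
  linarith
end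
end

section
/- Let i, j, k_i, k_j be integers with 0 ≤ i ≤ j ≤ p − 2, k_j ≤ k_i and i + k_i ≤ j + k_j, and let g, h ∈ G with g ≠ h. Set δ^i := 0 if i = 0 and δ^i := 1 otherwise, and δ_j := 1 if j = p − 2 and δ_j := 0 otherwise. Let G' := G if i = 0 and j = p−2; G' := G∖{h} if i = 0 and j ≠ p−2; G' := G∖{g} if i ≠ 0 and j = p−2; and G' := G∖{g,h} if i ≠ 0 and j ≠ p−2. Define H := {ω + a·x₄ + q : a ∈ ℤ, k_j − δ_j ≤ a ≤ k_i − δ^i, q ∈ G'} ∪ {b·x₄ + q : b ∈ ℤ, i + k_i + δ^i − p − 1 ≤ b ≤ j + k_j + δ_j − p − 1, q ∈ G'} ⊆ L. Let I ⊆ H be an H-upset, i.e. whenever z ∈ I, u ∈ L₊ and z + u ∈ H then z + u ∈ I, and set S_I := I ∪ {z − ω : z ∈ H, z ∉ I}. Then for all x, y ∈ S_I, one has −2c ≤ y − x ≤ 2c. -/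
noncomputable section

theorem aux_tors {A : Type*} [AddCommGroup A] (M : AddSubmonoid A) (x0 x1 x2 c : A)
    (m0 : x0 ∈ M) (m1 : x1 ∈ M) (m2 : x2 ∈ M)
    (r0 : (2 : ℤ) • x0 = c) (r1 : (2 : ℤ) • x1 = c) (r2 : (2 : ℤ) • x2 = c)
    (q q' : A) (hq : q = 0 ∨ q = x0 - x1 ∨ q = x0 - x2 ∨ q = x1 - x2)
    (hq' : q' = 0 ∨ q' = x0 - x1 ∨ q' = x0 - x2 ∨ q' = x1 - x2) :
    q = q' ∨ (q - q' + c ∈ M ∧ q - q' + (x0 + x1 + x2 - c) ∈ M ∧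
      q' - q + (x0 + x1 + x2 - c) ∈ M) := by
  have key : q - q' = 0 ∨ q - q' = x0 - x1 ∨ q - q' = x0 - x2 ∨ q - q' = x1 - x2 := by
    rcases hq with rfl | rfl | rfl | rfl <;> rcases hq' with rfl | rfl | rfl | rfl
    · left; module
    · right; left; linear_combination (norm := module) r1 - r0
    · right; right; left; linear_combination (norm := module) r2 - r0
    · right; right; right; linear_combination (norm := module) r2 - r1
    · right; left; module
    · left; module
    · right; right; right; linear_combination (norm := module) r2 - r1
    · right; right; left; linear_combination (norm := module) r2 - r1
    · right; right; left; module
    · right; right; right; module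
    · left; module
    · right; left; module
    · right; right; right; module
    · right; right; left; linear_combination (norm := module) r1 - r0
    · right; left; linear_combination (norm := module) r1 - r0
    · left; module
  rcases key with h | h | h | h
  · left; exact sub_eq_zero.mp h
  · right
    have e1 : q - q' + c = x0 + x1 := by linear_combination (norm := module) h - r1
    have e2 : q - q' + (x0 + x1 + x2 - c) = x2 := by linear_combination (norm := module) h + r0
    have e3 : q' - q + (x0 + x1 + x2 - c) = x2 := by linear_combination (norm := module) r1 - h
    rw [e1, e2, e3]
    exact ⟨M.add_mem m0 m1, m2, m2⟩
  · right
    have e1 : q - q' + c = x0 + x2 := by linear_combination (norm := module) h - r2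
    have e2 : q - q' + (x0 + x1 + x2 - c) = x1 := by linear_combination (norm := module) h + r0
    have e3 : q' - q + (x0 + x1 + x2 - c) = x1 := by linear_combination (norm := module) r2 - h
    rw [e1, e2, e3]
    exact ⟨M.add_mem m0 m2, m1, m1⟩
  · right
    have e1 : q - q' + c = x1 + x2 := by linear_combination (norm := module) h - r2
    have e2 : q - q' + (x0 + x1 + x2 - c) = x0 := by linear_combination (norm := module) h + r1
    have e3 : q' - q + (x0 + x1 + x2 - c) = x0 := by linear_combination (norm := module) r2 - h
    rw [e1, e2, e3]
    exact ⟨M.add_mem m1 m2, m0, m0⟩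

/-- The one-sided bound, in an abstract abelian group; `P` is the set `G'`. -/
theorem aux_main {A : Type*} [AddCommGroup A] (M : AddSubmonoid A) (x0 x1 x2 x3 c w : A)
    (m0 : x0 ∈ M) (m1 : x1 ∈ M) (m2 : x2 ∈ M) (m3 : x3 ∈ M) (mc : c ∈ M) (p : ℤ) (hp : 2 ≤ p)
    (r0 : (2 : ℤ) • x0 = c) (r1 : (2 : ℤ) • x1 = c) (r2 : (2 : ℤ) • x2 = c)
    (r3 : p • x3 = c) (hw : w = c - x0 - x1 - x2 - x3)
    (P : Set A) (hP : ∀ q ∈ P, q = 0 ∨ q = x0 - x1 ∨ q = x0 - x2 ∨ q = x1 - x2)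
    (a0 a1 b0 b1 : ℤ) (hA : a1 - a0 ≤ p - 1) (hB : b1 - b0 ≤ p - 1)
    (hAB : 1 ≤ a0 - b1) (hBA : -p - 1 ≤ b0 - a1)
    (H I S : Set A)
    (hH : H = {z | ∃ a : ℤ, a0 ≤ a ∧ a ≤ a1 ∧ ∃ q ∈ P, z = w + a • x3 + q}
             ∪ {z | ∃ b : ℤ, b0 ≤ b ∧ b ≤ b1 ∧ ∃ q ∈ P, z = b • x3 + q})
    (hIH : I ⊆ H) (hup : ∀ z ∈ I, ∀ u ∈ M, z + u ∈ H → z + u ∈ I)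
    (hS : S = I ∪ {v | ∃ z ∈ H, z ∉ I ∧ v = z - w})
    (x y : A) (hx : x ∈ S) (hy : y ∈ S) : (2 : ℤ) • c + x - y ∈ M := by
  have tors : ∀ q ∈ P, ∀ q' ∈ P, q = q' ∨ (q - q' + c ∈ M ∧ q - q' + (x0 + x1 + x2 - c) ∈ M ∧
      q' - q + (x0 + x1 + x2 - c) ∈ M) := fun q hq q' hq' =>
    aux_tors M x0 x1 x2 c m0 m1 m2 r0 r1 r2 q q' (hP q hq) (hP q' hq')
  have n3 : ∀ n : ℤ, 0 ≤ n → n • x3 ∈ M := by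
    intro n hn
    lift n to ℕ using hn
    rw [natCast_zsmul]
    exact M.nsmul_mem m3 n
  -- torsion plus `c`
  have tc : ∀ q ∈ P, ∀ q' ∈ P, q - q' + c ∈ M := by
    intro q hq q' hq'
    rcases tors q hq q' hq' with rfl | h
    · simpa using mc
    · exact h.1
  have te : ∀ q ∈ P, ∀ q' ∈ P, q - q' + (x0 + x1 + x2) ∈ M := by
    intro q hq q' hq'
    rcases tors q hq q' hq' with rfl | h
    · simpa using M.add_mem (M.add_mem m0 m1) m2
    · convert M.add_mem h.2.1 mc using 1; abel
  have up : ∀ z ∈ I, ∀ z' ∈ H, z' ∉ I → z' - z ∉ M := by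
    intro z hz z' hz' hn hm
    have := hup z hz _ hm (by simpa using hz')
    exact hn (by simpa using this)
  -- same-side comparison
  have same : ∀ z ∈ H, ∀ z' ∈ H, (2 : ℤ) • c + z - z' ∈ M := by
    intro z hz z' hz'
    rw [hH] at hz hz'
    rcases hz with ⟨a, h1, h2, q, hq, rfl⟩ | ⟨a, h1, h2, q, hq, rfl⟩ <;>
    rcases hz' with ⟨b, h3, h4, q', hq', rfl⟩ | ⟨b, h3, h4, q', hq', rfl⟩
    · convert M.add_mem (tc q hq q' hq') (n3 (a - b + p) (by omega)) using 1
      linear_combination (norm := module) -r3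
    · convert M.add_mem (te q hq q' hq') (n3 (a - b - 1) (by omega)) using 1
      linear_combination (norm := module) hw - r0 - r1 - r2
    · convert M.add_mem (te q hq q' hq') (n3 (a - b + 1 + p) (by omega)) using 1
      linear_combination (norm := module) -hw - r3
    · convert M.add_mem (tc q hq q' hq') (n3 (a - b + p) (by omega)) using 1
      linear_combination (norm := module) -r3
  rw [hS] at hx hy
  rcases hx with hx | ⟨z, hz, hzI, rfl⟩ <;> rcases hy with hy | ⟨z', hz', hzI', rfl⟩
  · exact same x (hIH hx) y (hIH hy)
  · have hc := up x hx z' hz' hzI'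
    have hxH := hIH hx
    rw [hH] at hxH hz'
    rcases hxH with ⟨a, h1, h2, q, hq, rfl⟩ | ⟨a, h1, h2, q, hq, rfl⟩ <;>
    rcases hz' with ⟨b, h3, h4, q', hq', rfl⟩ | ⟨b, h3, h4, q', hq', rfl⟩
    · rcases tors q hq q' hq' with rfl | ⟨t1, t2, t3⟩
      · have : b < a := by
          by_contra hlt
          apply hc
          convert n3 (b - a) (by omega) using 1
          module
        convert M.add_mem (te q hq q hq) (n3 (a - b - 1) (by omega)) using 1
        linear_combination (norm := module) hw - r0 - r1 - r2
      · convert M.add_mem t2 (n3 (a - b - 1 + p) (by omega)) using 1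
        linear_combination (norm := module) hw - r3 - r0 - r1 - r2
    · rcases tors q hq q' hq' with rfl | ⟨t1, t2, t3⟩
      · convert n3 (a - b - 2 + p) (by omega) using 1
        linear_combination (norm := module) (2 : ℤ) • hw - r3 - r0 - r1 - r2
      · have : b - a + 1 < 0 := by
          by_contra hlt
          apply hc
          convert M.add_mem t3 (n3 (b - a + 1) (by omega)) using 1
          linear_combination (norm := module) -hw
        convert M.add_mem t1 (n3 (a - b - 2) (by omega)) using 1
        linear_combination (norm := module) (2 : ℤ) • hw - r0 - r1 - r2
    · rcases tors q hq q' hq' with rfl | ⟨t1, t2, t3⟩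
      · convert n3 (a - b + p + p) (by omega) using 1
        linear_combination (norm := module) -(2 : ℤ) • r3
      · have : b - a - 1 - p < 0 := by
          by_contra hlt
          apply hc
          convert M.add_mem t3 (n3 (b - a - 1 - p) (by omega)) using 1
          linear_combination (norm := module) hw + r3 - r0 - r1 - r2
        convert M.add_mem t1 (n3 (a - b + p) (by omega)) using 1
        linear_combination (norm := module) -r3
    · rcases tors q hq q' hq' with rfl | ⟨t1, t2, t3⟩
      · have : b < a := by
          by_contra hlt
          apply hc
          convert n3 (b - a) (by omega) using 1
          module
        convert M.add_mem (te q hq q hq) (n3 (a - b - 1) (by omega)) using 1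
        linear_combination (norm := module) hw - r0 - r1 - r2
      · convert M.add_mem t2 (n3 (a - b - 1 + p) (by omega)) using 1
        linear_combination (norm := module) hw - r3 - r0 - r1 - r2
  · have hyH := hIH hy
    rw [hH] at hyH hz
    rcases hz with ⟨a, h1, h2, q, hq, rfl⟩ | ⟨a, h1, h2, q, hq, rfl⟩ <;>
    rcases hyH with ⟨b, h3, h4, q', hq', rfl⟩ | ⟨b, h3, h4, q', hq', rfl⟩
    · convert M.add_mem (te q hq q' hq') (n3 (a - b + 1 + p) (by omega)) using 1
      linear_combination (norm := module) -hw - r3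
    · convert M.add_mem (tc q hq q' hq') (n3 (a - b + p) (by omega)) using 1
      linear_combination (norm := module) -r3
    · convert M.add_mem (tc q hq q' hq') (n3 (a - b + 2 + p + p) (by omega)) using 1
      linear_combination (norm := module) -(2 : ℤ) • hw - (2 : ℤ) • r3 + r0 + r1 + r2
    · convert M.add_mem (te q hq q' hq') (n3 (a - b + 1 + p) (by omega)) using 1
      linear_combination (norm := module) -hw - r3
  · convert same z hz z' hz' using 1
    abel

/-- For the set `S_I = I ∪ ((H − ω) ∖ (I − ω))` built from an `H`-upset `I`,
any two elements `x, y ∈ S_I` satisfy `−2c ≤ y − x ≤ 2c`. -/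
theorem stmt_15 (p : ℤ) (hp : 2 ≤ p) (i j ki kj : ℤ)
    (hi : 0 ≤ i) (hij : i ≤ j) (hj : j ≤ p - 2) (hk1 : kj ≤ ki) (hk2 : i + ki ≤ j + kj)
    (g h : Lgrp p) (hg : g ∈ Gset p) (hh : h ∈ Gset p) (hgh : g ≠ h)
    (di dj : ℤ) (hdi : di = if i = 0 then 0 else 1) (hdj : dj = if j = p - 2 then 1 else 0)
    (G' : Set (Lgrp p))
    (hG' : G' = if i = 0 then (if j = p - 2 then Gset p else Gset p \ {h})
                else (if j = p - 2 then Gset p \ {g} else Gset p \ {g, h}))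
    (H : Set (Lgrp p))
    (hH : H = {z | ∃ a : ℤ, kj - dj ≤ a ∧ a ≤ ki - di ∧
                    ∃ q ∈ G', z = omg p + a • gen p 3 + q}
             ∪ {z | ∃ b : ℤ, i + ki + di - p - 1 ≤ b ∧ b ≤ j + kj + dj - p - 1 ∧
                    ∃ q ∈ G', z = b • gen p 3 + q})
    (I : Set (Lgrp p)) (hIH : I ⊆ H)
    (hup : ∀ z ∈ I, ∀ u ∈ Lplus p, z + u ∈ H → z + u ∈ I)
    (S : Set (Lgrp p))
    (hS : S = I ∪ {w | ∃ z ∈ H, z ∉ I ∧ w = z - omg p})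
    (x y : Lgrp p) (hx : x ∈ S) (hy : y ∈ S) :
    Lle p (-((2 : ℤ) • cel p)) (y - x) ∧ Lle p (y - x) ((2 : ℤ) • cel p) := by
  have mem : ∀ k, gen p k ∈ Lplus p := fun k => AddSubmonoid.subset_closure ⟨k, rfl⟩
  have rel : ∀ (n : ℤ) (k : Fin 5),
      n • (Pi.single k 1 : Fin 5 → ℤ) - Pi.single 4 1 ∈ rels p → n • gen p k = cel p := by
    intro n k hk
    have h0 := (QuotientAddGroup.eq_zero_iff _).mpr
      (AddSubgroup.subset_closure (k := rels p) hk)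
    exact sub_eq_zero.mp h0
  have r0 := rel 2 0 (by simp [rels])
  have r1 := rel 2 1 (by simp [rels])
  have r2 := rel 2 2 (by simp [rels])
  have r3 := rel p 3 (by simp [rels])
  have hP : ∀ q ∈ G', q = 0 ∨ q = gen p 0 - gen p 1 ∨ q = gen p 0 - gen p 2 ∨
      q = gen p 1 - gen p 2 := by
    intro q hq
    have hsub : q ∈ Gset p := by
      rw [hG'] at hq
      split_ifs at hq
      · exact hq
      · exact hq.1
      · exact hq.1
      · exact hq.1
    simpa [Gset] using hsub
  have hdi' : 0 ≤ di := by rw [hdi]; split_ifs <;> omega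
  have hdj' : 0 ≤ dj ∧ j + 2 * dj ≤ p := by rw [hdj]; split_ifs <;> omega
  have key := aux_main (Lplus p) (gen p 0) (gen p 1) (gen p 2) (gen p 3) (cel p) (omg p)
    (mem 0) (mem 1) (mem 2) (mem 3) (mem 4) p hp r0 r1 r2 r3 rfl G' hP
    (kj - dj) (ki - di) (i + ki + di - p - 1) (j + kj + dj - p - 1)
    (by have : j + dj ≤ p - 1 := by
          rw [hdj]; split_ifs <;> omega
        omega) (by have : j + dj ≤ p - 1 := by
                     rw [hdj]; split_ifs <;> omega
                   omega) (by omega) (by omega) H I S hH hIH hup hS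
  constructor
  · have := key y x hy hx
    unfold Lle
    convert this using 1
    abel
  · have := key x y hx hy
    unfold Lle
    convert this using 1
    abel
end
end

section
/- Let k_i, k_j be integers with k_j ≤ k_i ≤ k_j + p − 2 (the case i = 0, j = p − 2). Define H := {ω + a·x₄ + q : a ∈ ℤ, k_j − 1 ≤ a ≤ k_i, q ∈ G} ∪ {b·x₄ + q : b ∈ ℤ, k_i − p − 1 ≤ b ≤ k_j − 2, q ∈ G} ⊆ L. Let I ⊆ H be an H-upset, i.e. whenever z ∈ I, u ∈ L₊ and z + u ∈ H then z + u ∈ I, and set S_I := I ∪ {z − ω : z ∈ H, z ∉ I}. Then S_I is a complete set of representatives for the cosets of the subgroup ℤ·ω in L: for every x ∈ L, the intersection of S_I with the coset x + ℤ·ω has exactly one element. -/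
noncomputable section

theorem exists_hom_aux (p : ℤ) {A : Type} [AddCommGroup A] (f : Fin 5 → A)
    (h0 : (2 : ℤ) • f 0 = f 4) (h1 : (2 : ℤ) • f 1 = f 4) (h2 : (2 : ℤ) • f 2 = f 4)
    (h3 : p • f 3 = f 4) : ∃ φ : Lgrp p →+ A, ∀ i, φ (gen p i) = f i := by
  have hs : ∀ i, (Fintype.linearCombination ℤ f).toAddMonoidHom (Pi.single i 1) = f i := by
    intro i
    simp [Fintype.linearCombination_apply_single]
  refine ⟨QuotientAddGroup.lift _ (Fintype.linearCombination ℤ f).toAddMonoidHom ?_, ?_⟩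
  · rw [AddSubgroup.closure_le]
    intro v hv
    simp only [rels, Set.mem_insert_iff, Set.mem_singleton_iff] at hv
    rw [SetLike.mem_coe, AddMonoidHom.mem_ker]
    rcases hv with rfl | rfl | rfl | rfl <;>
      rw [map_sub, map_zsmul, hs, hs] <;> rw [sub_eq_zero] <;> assumption
  · intro i
    exact hs i

theorem rel_aux (p : ℤ) : (2 : ℤ) • gen p 0 = gen p 4 ∧ (2 : ℤ) • gen p 1 = gen p 4 ∧
    (2 : ℤ) • gen p 2 = gen p 4 ∧ p • gen p 3 = gen p 4 := by
  have key : ∀ (n : ℤ) (i : Fin 5),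
      n • (Pi.single i 1 : Fin 5 → ℤ) - Pi.single 4 1 ∈ rels p → n • gen p i = gen p 4 := by
    intro n i h
    have h' : ((n • (Pi.single i 1 : Fin 5 → ℤ) - Pi.single 4 1 : Fin 5 → ℤ) : Lgrp p) = 0 :=
      (QuotientAddGroup.eq_zero_iff _).2 (AddSubgroup.subset_closure h)
    exact sub_eq_zero.1 h'
  refine ⟨key _ _ ?_, key _ _ ?_, key _ _ ?_, key _ _ ?_⟩ <;> simp [rels]

theorem span_aux (p : ℤ) (x : Lgrp p) : ∃ v : Fin 5 → ℤ, x = v 0 • gen p 0 + v 1 • gen p 1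
    + v 2 • gen p 2 + v 3 • gen p 3 + v 4 • gen p 4 := by
  obtain ⟨v, rfl⟩ := QuotientAddGroup.mk_surjective x
  refine ⟨v, ?_⟩
  have hv : v = v 0 • (Pi.single 0 1 : Fin 5 → ℤ) + v 1 • (Pi.single 1 1 : Fin 5 → ℤ)
      + v 2 • (Pi.single 2 1 : Fin 5 → ℤ) + v 3 • (Pi.single 3 1 : Fin 5 → ℤ)
      + v 4 • (Pi.single 4 1 : Fin 5 → ℤ) := by
    ext i
    fin_cases i <;> simp
  exact congrArg (QuotientAddGroup.mk : (Fin 5 → ℤ) → Lgrp p) hv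

theorem G_aux (p : ℤ) (s t : ℤ) :
    s • (gen p 0 - gen p 1) + t • (gen p 0 - gen p 2) ∈ Gset p := by
  obtain ⟨h0, h1, h2, -⟩ := rel_aux p
  simp only [Gset, Set.mem_insert_iff, Set.mem_singleton_iff]
  obtain ⟨m, rfl | rfl⟩ := Int.even_or_odd' s <;> obtain ⟨n, rfl | rfl⟩ := Int.even_or_odd' t
  · left
    linear_combination (norm := module) (m + n) • h0 - m • h1 - n • h2
  · right; right; left
    linear_combination (norm := module) (m + n) • h0 - m • h1 - n • h2
  · right; left
    linear_combination (norm := module) (m + n) • h0 - m • h1 - n • h2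
  · right; right; right
    linear_combination (norm := module) (m + n + 1) • h0 - (m + 1) • h1 - n • h2

theorem decomp_aux (p : ℤ) (x : Lgrp p) :
    ∃ b n : ℤ, ∃ q ∈ Gset p, x = b • gen p 3 + q + n • omg p := by
  obtain ⟨v, hv⟩ := span_aux p x
  obtain ⟨h0, h1, h2, h3⟩ := rel_aux p
  -- x₁ = -x₄ - ω + g₁ + g₂ up to relations
  refine ⟨-(v 0 + v 1 + v 2) + v 3 + p * v 4, -(v 0 + v 1 + v 2), _,
    G_aux p (v 0 + v 1 + v 2 - v 1) (v 0 + v 1 + v 2 - v 2), ?_⟩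
  rw [hv, omg, cel]
  linear_combination (norm := module) (v 0 + v 1 + v 2) • (-h0) - v 4 • h3

theorem shift_aux (p : ℤ) (m : ℤ) : (m * (p + 2)) • gen p 3 = (-2 * m) • omg p := by
  obtain ⟨h0, h1, h2, h3⟩ := rel_aux p
  rw [omg, cel]
  linear_combination (norm := module) m • (h3 - h0 - h1 - h2)

theorem unique_aux (p : ℤ) (hp : 2 ≤ p) (a a' n : ℤ) (q q' : Lgrp p) (hq : q ∈ Gset p)
    (hq' : q' ∈ Gset p) (h : a' • gen p 3 + q' = a • gen p 3 + q + n • omg p)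
    (h1 : a - a' < p + 2) (h2 : a' - a < p + 2) : a' = a ∧ q' = q := by
  have ha : a' = a := by
    have hn : (((p + 2).toNat : ℕ) : ℤ) = p + 2 := by omega
    have hz : ((p : ℤ) : ZMod (p + 2).toNat) + 2 = 0 := by
      have := (ZMod.intCast_zmod_eq_zero_iff_dvd (p + 2) (p + 2).toNat).2 (by rw [hn])
      push_cast at this
      exact this
    obtain ⟨φ, hφ⟩ := exists_hom_aux p (A := ZMod (p + 2).toNat) ![-1, -1, -1, 1, -2]
      (by simp) (by simp) (by simp)
      (by simp; linear_combination hz)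
    have hG : ∀ q ∈ Gset p, φ q = 0 := by
      intro q hq
      simp only [Gset, Set.mem_insert_iff, Set.mem_singleton_iff] at hq
      rcases hq with rfl | rfl | rfl | rfl <;> simp [hφ]
    have hw : φ (omg p) = 0 := by
      simp [omg, cel, hφ]; ring
    have e := congrArg φ h
    simp only [map_add, map_zsmul, hG q hq, hG q' hq', hw, hφ] at e
    simp at e
    rw [ZMod.intCast_eq_intCast_iff_dvd_sub, hn] at e
    obtain ⟨c, hc⟩ := e
    have hc1 : c < 1 := by nlinarith
    have hc2 : -1 < c := by nlinarith
    have : c = 0 := by omega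
    subst this
    linarith
  subst ha
  refine ⟨rfl, ?_⟩
  obtain ⟨φ, hφ⟩ := exists_hom_aux p (A := ℤ) ![p, p, p, 2, 2 * p]
      (by simp) (by simp) (by simp) (by simp; ring)
  have hG : ∀ q ∈ Gset p, φ q = 0 := by
    intro q hq
    simp only [Gset, Set.mem_insert_iff, Set.mem_singleton_iff] at hq
    rcases hq with rfl | rfl | rfl | rfl <;> simp [hφ]
  have hw : φ (omg p) = -(p + 2) := by
    simp [omg, cel, hφ]; ring
  have e := congrArg φ h
  simp only [map_add, map_zsmul, hG q hq, hG q' hq', hw] at e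
  have hn : n = 0 := by
    have : n * (p + 2) = 0 := by
      simp only [smul_eq_mul] at e
      linarith
    rcases mul_eq_zero.1 this with h | h
    · exact h
    · omega
  subst hn
  simpa [add_assoc] using h

/-- In the case `i = 0`, `j = p − 2`: the set `S_I` built from an `H`-upset `I` is a
complete set of representatives for the cosets of `ℤ·ω` in `L`. -/
theorem stmt_18 (p : ℤ) (hp : 2 ≤ p) (ki kj : ℤ) (hk1 : kj ≤ ki) (hk2 : ki ≤ kj + p - 2)
    (H : Set (Lgrp p))
    (hH : H = {z | ∃ a : ℤ, kj - 1 ≤ a ∧ a ≤ ki ∧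
                    ∃ q ∈ Gset p, z = omg p + a • gen p 3 + q}
             ∪ {z | ∃ b : ℤ, ki - p - 1 ≤ b ∧ b ≤ kj - 2 ∧
                    ∃ q ∈ Gset p, z = b • gen p 3 + q})
    (I : Set (Lgrp p)) (hIH : I ⊆ H)
    (hup : ∀ z ∈ I, ∀ u ∈ Lplus p, z + u ∈ H → z + u ∈ I)
    (S : Set (Lgrp p))
    (hS : S = I ∪ {w | ∃ z ∈ H, z ∉ I ∧ w = z - omg p})
    (x : Lgrp p) :
    ∃! y : Lgrp p, y ∈ S ∧ ∃ n : ℤ, y = x + n • omg p := by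
  -- every element of `H` is determined by its class modulo `ω`
  have huniq : ∀ z ∈ H, ∀ z' ∈ H, ∀ n : ℤ, z' = z + n • omg p → z' = z := by
    intro z hz z' hz' n hn
    rw [hH] at hz hz'
    rcases hz with ⟨a, ha1, ha2, q, hq, rfl⟩ | ⟨a, ha1, ha2, q, hq, rfl⟩ <;>
    rcases hz' with ⟨a', ha1', ha2', q', hq', rfl⟩ | ⟨a', ha1', ha2', q', hq', rfl⟩
    · obtain ⟨h1, h2⟩ := unique_aux p hp a a' n q q' hq hq'
        (by linear_combination (norm := module) hn) (by omega) (by omega)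
      rw [h1, h2]
    · obtain ⟨h1, h2⟩ := unique_aux p hp a a' (n + 1) q q' hq hq'
        (by linear_combination (norm := module) hn) (by omega) (by omega)
      omega
    · obtain ⟨h1, h2⟩ := unique_aux p hp a a' (n - 1) q q' hq hq'
        (by linear_combination (norm := module) hn) (by omega) (by omega)
      omega
    · obtain ⟨h1, h2⟩ := unique_aux p hp a a' n q q' hq hq'
        (by linear_combination (norm := module) hn) (by omega) (by omega)
      rw [h1, h2]
  have hex : ∃ z ∈ H, ∃ n : ℤ, z = x + n • omg p := by
    obtain ⟨b, n, q, hq, hx⟩ := decomp_aux p x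
    have hpos : 0 < p + 2 := by omega
    have hr := Int.emod_add_mul_ediv (b - (ki - p - 1)) (p + 2)
    have hr1 := Int.emod_nonneg (b - (ki - p - 1)) hpos.ne'
    have hr2 := Int.emod_lt_of_pos (b - (ki - p - 1)) hpos
    set r := (b - (ki - p - 1)) % (p + 2)
    set m := (b - (ki - p - 1)) / (p + 2)
    have hb : b = (r + (ki - p - 1)) + m * (p + 2) := by linarith
    have hs := shift_aux p m
    rw [hb, add_zsmul, hs] at hx
    rw [hH]
    by_cases hc : r + (ki - p - 1) ≤ kj - 2
    · refine ⟨_, Or.inr ⟨r + (ki - p - 1), by omega, hc, q, hq, rfl⟩, 2 * m - n, ?_⟩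
      rw [hx]
      module
    · refine ⟨_, Or.inl ⟨r + (ki - p - 1), by omega, by omega, q, hq, rfl⟩, 2 * m - n + 1, ?_⟩
      rw [hx]
      module
  obtain ⟨z, hz, n, hn⟩ := hex
  -- elements of `S` in the coset come from `z`
  have hSz : ∀ y, y ∈ S → (∃ k : ℤ, y = x + k • omg p) →
      (z ∈ I ∧ y = z) ∨ (z ∉ I ∧ y = z - omg p) := by
    rintro y hy ⟨k, hk⟩
    rw [hS] at hy
    rcases hy with hy | ⟨w, hw, hwI, rfl⟩
    · have : y = z := huniq z hz y (hIH hy) (k - n) (by rw [hk, hn]; module)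
      subst this
      exact Or.inl ⟨hy, rfl⟩
    · have : w = z := huniq z hz w hw (k - n + 1) (by
        rw [hn]; linear_combination (norm := module) hk)
      subst this
      exact Or.inr ⟨hwI, rfl⟩
  by_cases hzI : z ∈ I
  · refine ⟨z, ⟨by rw [hS]; exact Or.inl hzI, n, hn⟩, ?_⟩
    rintro y ⟨hy, hk⟩
    rcases hSz y hy hk with h | h
    · exact h.2
    · exact absurd hzI h.1
  · refine ⟨z - omg p, ⟨by rw [hS]; exact Or.inr ⟨z, hz, hzI, rfl⟩, n - 1, by rw [hn]; module⟩, ?_⟩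
    rintro y ⟨hy, hk⟩
    rcases hSz y hy hk with h | h
    · exact absurd h.1 hzI
    · exact h.2
end
end
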